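/- arXiv:math/0507154 — 6 statements merged into one kernel-verified Lean document; each statement's English description precedes it below -/
import Mathlib

section
/- (Speiser's lemma / no-name lemma for finite groups.) Let k be a field of characteristic zero, G a finite group, and let V and W be two faithful finite-dimensional linear representations of G over k. Then the invariant fields k(V)^G and k(W)^G are stably equivalent over k: there exist integers r, s ≥ 0 and independent variables x_1,…,x_r and y_1,…,y_s such that the fields k(V)^G(x_1,…,x_r) and k(W)^G(y_1,…,y_s) are isomorphic as k-algebras. -/
open MvPolynomial

section Descent

variable {k K G ι : Type*} [Field k] [Field K] [Algebra k K] [Group G] [Finite G]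
  [Fintype ι] [DecidableEq ι]

/-- The vectors on which a semilinear action of `G` on `K ^ ι` agrees with the twist by a linear
representation span `K ^ ι`. -/
theorem span_semiinvariant_eq_top (a : G →* (K ≃ₐ[k] K)) (ha : Function.Injective a)
    (ρ : G →* Matrix ι ι k) :
    Submodule.span K {v : ι → K | ∀ g, (fun i => a g (v i)) =
      Matrix.vecMul v ((ρ g).map (algebraMap k K))} = ⊤ := by
  have := Fintype.ofFinite G
  by_contra h
  obtain ⟨f, hf, hle⟩ := Submodule.exists_le_ker_of_lt_top _ (lt_top_iff_ne_top.2 h)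
  refine hf (LinearMap.pi_ext' fun i => LinearMap.ext_ring ?_)
  let w (g : G) : ι → K := fun j => algebraMap k K (ρ g⁻¹ i j)
  have key (c : K) : ∑ g, f (w g) * a g c = 0 := by
    have hmem : (∑ g, a g c • w g) ∈ {v : ι → K | ∀ g, (fun i => a g (v i)) =
        Matrix.vecMul v ((ρ g).map (algebraMap k K))} := by
      intro h
      ext j
      simp only [Finset.sum_apply, Pi.smul_apply, smul_eq_mul, map_sum, map_mul,
        Matrix.vecMul, dotProduct, Matrix.map_apply, w, AlgEquiv.commutes, Finset.sum_mul]
      rw [Finset.sum_comm]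
      symm
      rw [← Equiv.sum_comp (Equiv.mulLeft h)]
      refine Finset.sum_congr rfl fun g _ => ?_
      have : ρ g⁻¹ = ρ (h * g)⁻¹ * ρ h := by rw [← map_mul]; simp
      rw [this, Matrix.mul_apply, map_sum, Finset.mul_sum]
      exact Finset.sum_congr rfl fun l _ => by simp [mul_assoc]
    have := hle (Submodule.subset_span hmem)
    simpa [mul_comm] using this
  have hli := (linearIndependent_monoidHom K K).comp
    (fun g : G => ((a g : K →ₐ[k] K) : K →* K)) fun g h hgh => ha (AlgEquiv.ext fun x =>
      DFunLike.congr_fun hgh x)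
  have h1 := Fintype.linearIndependent_iff.1 hli (fun g => f (w g))
    (by ext c; simpa using key c) 1
  simp only [w, inv_one, map_one] at h1
  rw [LinearMap.zero_comp, LinearMap.zero_apply, ← h1]
  refine congrArg f (funext fun j => ?_)
  simp [Pi.single_apply, Matrix.one_apply, eq_comm, apply_ite]

/-- Hilbert's Theorem 90 for `GLₙ`, for cocycles coming from a linear representation. -/
theorem exists_isUnit_map_eq_mul (a : G →* (K ≃ₐ[k] K)) (ha : Function.Injective a)
    (ρ : G →* Matrix ι ι k) :
    ∃ A : Matrix ι ι K, IsUnit A ∧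
      ∀ g, A.map (a g) = A * (ρ g).map (algebraMap k K) := by
  obtain ⟨b, hb, hspan, hli⟩ := exists_linearIndependent K {v : ι → K | ∀ g, (fun i => a g (v i)) =
      Matrix.vecMul v ((ρ g).map (algebraMap k K))}
  rw [span_semiinvariant_eq_top a ha ρ] at hspan
  let B := Module.Basis.mk hli (by simp [hspan])
  let e := B.indexEquiv (Pi.basisFun K ι)
  refine ⟨Matrix.of fun i => (e.symm i : ι → K), ?_, fun g => ?_⟩
  · rw [← Matrix.linearIndependent_rows_iff_isUnit]
    exact hli.comp _ e.symm.injective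
  · ext i j
    exact congrFun (hb (e.symm i).2 g) j

end Descent

section LinearChange

variable {K L ι : Type*} [Field K] [Field L] [Algebra K L] [Fintype ι]

theorem sum_smul_sum_smul {M : Type*} [AddCommMonoid M] [Module K M] (A B : Matrix ι ι K)
    (y : ι → M) (i : ι) :
    ∑ j, A i j • ∑ l, B j l • y l = ∑ l, (A * B) i l • y l := by
  simp_rw [Finset.smul_sum, smul_smul, Matrix.mul_apply, Finset.sum_smul]
  exact Finset.sum_comm

variable [DecidableEq ι]

theorem sum_inv_smul_sum_smul {M : Type*} [AddCommMonoid M] [Module K M] {A : Matrix ι ι K}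
    (hA : IsUnit A) (y : ι → M) (i : ι) :
    ∑ j, A⁻¹ i j • ∑ l, A j l • y l = y i := by
  rw [sum_smul_sum_smul, Matrix.nonsing_inv_mul A ((Matrix.isUnit_iff_isUnit_det A).1 hA)]
  simp [Matrix.one_apply]

theorem AlgebraicIndependent.linear_change {y : ι → L} (hy : AlgebraicIndependent K y)
    {A : Matrix ι ι K} (hA : IsUnit A) :
    AlgebraicIndependent K fun i => ∑ j, A i j • y j := by
  have hdet := (Matrix.isUnit_iff_isUnit_det A).1 hA
  let φ (B : Matrix ι ι K) : MvPolynomial ι K →ₐ[K] MvPolynomial ι K :=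
    aeval fun i => ∑ j, B i j • X j
  have hφ : (φ A⁻¹).comp (φ A) = AlgHom.id K _ := by
    refine MvPolynomial.algHom_ext fun i => ?_
    simp only [φ, AlgHom.comp_apply, aeval_X, map_sum, map_smul, AlgHom.id_apply,
      sum_smul_sum_smul, Matrix.mul_nonsing_inv A hdet]
    simp [Matrix.one_apply]
  have hcomp : aeval (fun i => ∑ j, A i j • y j) = (aeval y).comp (φ A) :=
    MvPolynomial.algHom_ext fun i => by simp [φ]
  rw [algebraicIndependent_iff_injective_aeval, hcomp, AlgHom.coe_comp]
  exact Function.Injective.comp hy (Function.LeftInverse.injective (g := φ A⁻¹) (DFunLike.congr_fun hφ))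

end LinearChange

section FixedField

variable {k K L G ι : Type*} [Field k] [Field K] [Field L] [Algebra k K] [Algebra k L]
  [Algebra K L] [IsScalarTower k K L] [Group G]

theorem mem_fixedField_range_iff (a : G →* (K ≃ₐ[k] K)) (x : K) :
    x ∈ IntermediateField.fixedField a.range ↔ ∀ g, a g x = x := by
  simp [IntermediateField.mem_fixedField_iff]

variable [Finite G]

/-- A purely transcendental extension generated by invariants descends to fixed fields. -/
theorem adjoin_fixedField_eq (aK : G →* (K ≃ₐ[k] K)) (aL : G →* (L ≃ₐ[k] L))
    (hKL : ∀ g x, aL g (algebraMap K L x) = algebraMap K L (aK g x))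
    {z : ι → L} (hz : AlgebraicIndependent K z)
    (hgen : IntermediateField.adjoin K (Set.range z) = ⊤) (hfix : ∀ g i, aL g (z i) = z i) :
    (IntermediateField.adjoin (IntermediateField.fixedField aK.range)
      (Set.range z)).restrictScalars k = IntermediateField.fixedField aL.range := by
  have := Fintype.ofFinite G
  have hact (g : G) (p : MvPolynomial ι K) :
      aL g (aeval z p) = aeval z (map (aK g : K →+* K) p) := by
    induction p using MvPolynomial.induction_on with
    | C c => simp [hKL]
    | add p q hp hq => simp [hp, hq]
    | mul_X p i hp => simp [hp, hfix]
  have hdesc (p : MvPolynomial ι K) (hp : ∀ g, aL g (aeval z p) = aeval z p) :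
      ∃ q : MvPolynomial ι (IntermediateField.fixedField aK.range),
        aeval z q = aeval z p := by
    have hp' (g : G) : map (aK g : K →+* K) p = p := hz ((hact g p).symm.trans (hp g))
    have hmem : p ∈ Set.range (map (algebraMap (IntermediateField.fixedField aK.range) K)) := by
      rw [mem_range_map_iff_coeffs_subset]
      intro c hc
      obtain ⟨d, -, rfl⟩ := mem_coeffs_iff.1 hc
      refine ⟨⟨_, (mem_fixedField_range_iff aK _).2 fun g => ?_⟩, rfl⟩
      exact (coeff_map _ _ _).symm.trans (by rw [hp' g])
    obtain ⟨q, rfl⟩ := hmem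
    exact ⟨q, (aeval_map_algebraMap _ _ _).symm⟩
  apply le_antisymm
  · intro x hx
    rw [IntermediateField.mem_restrictScalars, IntermediateField.mem_adjoin_range_iff] at hx
    obtain ⟨p, q, rfl⟩ := hx
    rw [mem_fixedField_range_iff]
    have hinv (g : G) (p : MvPolynomial ι (IntermediateField.fixedField aK.range)) :
        aL g (aeval z p) = aeval z p := by
      rw [← aeval_map_algebraMap K, hact, map_map]
      refine congrArg (fun f => aeval z (map f p)) (RingHom.ext fun x => ?_)
      exact (mem_fixedField_range_iff aK _).1 x.2 g
    intro g
    rw [map_div₀, hinv, hinv]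
  · intro x hx
    rw [mem_fixedField_range_iff] at hx
    rw [IntermediateField.mem_restrictScalars, IntermediateField.mem_adjoin_range_iff]
    obtain ⟨p, q, rfl⟩ := (IntermediateField.mem_adjoin_range_iff K z x).1 (by simp [hgen])
    by_cases hq : aeval z q = 0
    · exact ⟨0, 0, by simp [hq]⟩
    let N : MvPolynomial ι K := ∏ g, map (aK g : K →+* K) q
    have hN : aeval z N = ∏ g, aL g (aeval z q) := by simp [N, map_prod, hact]
    have hN0 : aeval z N ≠ 0 := by
      rw [hN, Finset.prod_ne_zero_iff]
      simpa using hq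
    have hNfix (h : G) : aL h (aeval z N) = aeval z N := by
      rw [hN, map_prod, ← Equiv.prod_comp (Equiv.mulLeft h) fun g => aL g (aeval z q)]
      simp
    obtain ⟨c, hc⟩ : q ∣ N := by
      have := Finset.dvd_prod_of_mem (fun g => map (aK g : K →+* K) q) (Finset.mem_univ (1 : G))
      have h1 : map (aK 1 : K →+* K) q = q := by
        rw [map_one]
        exact map_id q
      rwa [h1] at this
    have hc0 : aeval z c ≠ 0 := fun h => hN0 (by simp [hc, h])
    have hx' : aeval z p / aeval z q = aeval z (p * c) / aeval z N := by
      rw [hc, map_mul, map_mul, mul_div_mul_right _ _ hc0]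
    have hP (g : G) : aL g (aeval z (p * c)) = aeval z (p * c) := by
      have := hx g
      rw [hx', map_div₀, hNfix] at this
      exact (div_left_inj' hN0).1 this
    obtain ⟨P', hP'⟩ := hdesc _ hP
    obtain ⟨N', hN'⟩ := hdesc _ hNfix
    exact ⟨P', N', by rw [hx', hP', hN']⟩

variable [Fintype ι] [DecidableEq ι]

/-- The no-name lemma: if `G` acts faithfully on `K`, and linearly on algebraically independent
generators `y` of `L` over `K`, then the fixed field of `L` is purely transcendental over the
fixed field of `K`. -/
theorem nonempty_fractionRing_algEquiv_fixedField (aK : G →* (K ≃ₐ[k] K))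
    (ha : Function.Injective aK) (aL : G →* (L ≃ₐ[k] L))
    (hKL : ∀ g x, aL g (algebraMap K L x) = algebraMap K L (aK g x))
    {y : ι → L} (hy : AlgebraicIndependent K y)
    (hgen : IntermediateField.adjoin K (Set.range y) = ⊤) (ρ : G →* Matrix ι ι k)
    (hyρ : ∀ g i, aL g (y i) = ∑ j, ρ g⁻¹ i j • y j) :
    Nonempty (FractionRing (MvPolynomial ι (IntermediateField.fixedField aK.range)) ≃ₐ[k]
      IntermediateField.fixedField aL.range) := by
  obtain ⟨A, hA, hAρ⟩ := exists_isUnit_map_eq_mul aK ha ρ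
  let z (i : ι) : L := ∑ j, A i j • y j
  have hz : AlgebraicIndependent K z := hy.linear_change hA
  have hzgen : IntermediateField.adjoin K (Set.range z) = ⊤ := by
    rw [eq_top_iff, ← hgen, IntermediateField.adjoin_le_iff]
    rintro _ ⟨i, rfl⟩
    rw [← sum_inv_smul_sum_smul hA y i]
    exact sum_mem fun j _ => IntermediateField.smul_mem _
      (IntermediateField.subset_adjoin K (Set.range z) ⟨j, rfl⟩)
  have hfix (g : G) (i : ι) : aL g (z i) = z i := by
    have hmul : A.map (aK g) * (ρ g⁻¹).map (algebraMap k K) = A := by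
      rw [hAρ, Matrix.mul_assoc, ← Matrix.map_mul, ← map_mul, mul_inv_cancel, map_one,
        Matrix.map_one _ (map_zero _) (map_one _), mul_one]
    have hsum := sum_smul_sum_smul (A.map (aK g)) ((ρ g⁻¹).map (algebraMap k K)) y i
    rw [hmul] at hsum
    calc aL g (z i) = ∑ j, (A.map (aK g)) i j •
          ∑ l, ((ρ g⁻¹).map (algebraMap k K)) j l • y l := by
          simp only [z, map_sum, Algebra.smul_def, map_mul, hKL, hyρ, Matrix.map_apply,
            ← IsScalarTower.algebraMap_apply]
      _ = z i := hsum
  have hzfix : AlgebraicIndependent (IntermediateField.fixedField aK.range) z :=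
    hz.restrictScalars
      (algebraMap (IntermediateField.fixedField aK.range) K).injective
  exact ⟨(hzfix.aevalEquivField.restrictScalars k).trans
    (IntermediateField.equivOfEq (adjoin_fixedField_eq aK aL hKL hz hzgen hfix))⟩

end FixedField

section RationalFunctions

variable {k L G ι κ : Type*} [Field k] [Field L] [Algebra k L] [Group G]

/-- The action on the rational function field induced by a linear representation. -/
theorem exists_linear_action [Fintype ι] [DecidableEq ι] (ρ : G →* Matrix ι ι k) :
    ∃ a : G →* (FractionRing (MvPolynomial ι k) ≃ₐ[k] FractionRing (MvPolynomial ι k)),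
      ∀ g i, a g (algebraMap _ _ (X i : MvPolynomial ι k)) =
        ∑ j, ρ g⁻¹ i j • algebraMap (MvPolynomial ι k) (FractionRing (MvPolynomial ι k)) (X j) := by
  let f : G →* (MvPolynomial ι k →ₐ[k] MvPolynomial ι k) :=
    { toFun := fun g => aeval fun i => ∑ j, ρ g⁻¹ i j • X j
      map_one' := MvPolynomial.algHom_ext fun i => by simp [Matrix.one_apply]
      map_mul' := fun g h => MvPolynomial.algHom_ext fun i => by
        simp only [aeval_X, AlgHom.mul_apply, map_sum, map_smul, mul_inv_rev, map_mul]
        exact (sum_smul_sum_smul (ρ h⁻¹) (ρ g⁻¹) (X : ι → MvPolynomial ι k) i).symm }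
  refine ⟨(IsFractionRing.fieldEquivOfAlgEquivHom k _).comp
    ((AlgEquiv.algHomUnitsEquiv k _).toMonoidHom.comp f.toHomUnits), fun g i => ?_⟩
  simp only [MonoidHom.comp_apply, IsFractionRing.fieldEquivOfAlgEquivHom_apply,
    IsFractionRing.fieldEquivOfAlgEquiv_algebraMap]
  have : f g (X i) = ∑ j, ρ g⁻¹ i j • X j := aeval_X _ _
  refine (congrArg (algebraMap (MvPolynomial ι k) (FractionRing (MvPolynomial ι k))) this).trans ?_
  rw [map_sum]
  exact Finset.sum_congr rfl fun j _ =>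
    map_smul (IsScalarTower.toAlgHom k (MvPolynomial ι k) (FractionRing (MvPolynomial ι k))) _ _

section Generic

variable {K : Type*} [Field K] [Algebra (MvPolynomial ι k) K]

theorem injective_of_action_X [Fintype ι] [DecidableEq ι] [Algebra k K]
    [IsFractionRing (MvPolynomial ι k) K] {ρ : G →* Matrix ι ι k} (hρ : Function.Injective ρ)
    {a : G →* (K ≃ₐ[k] K)}
    (ha : ∀ g i, a g (algebraMap (MvPolynomial ι k) K (X i)) =
      algebraMap (MvPolynomial ι k) K (∑ j, ρ g⁻¹ i j • X j)) :
    Function.Injective a := by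
  intro g h hgh
  suffices ρ g⁻¹ = ρ h⁻¹ from inv_injective (hρ this)
  ext i j
  have hX := ha g i
  rw [hgh, ha h i] at hX
  have := congrArg (coeff (Finsupp.single j 1)) (IsFractionRing.injective (MvPolynomial ι k) K hX)
  simpa [coeff_sum, coeff_X, Finsupp.single_left_inj, eq_comm] using this

variable [Algebra (MvPolynomial ι k) L] [Algebra K L] [IsScalarTower (MvPolynomial ι k) K L]

variable (K) in
theorem AlgebraicIndependent.fractionField_of_sumElim
    [IsFractionRing (MvPolynomial ι k) K] [IsScalarTower k (MvPolynomial ι k) L]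
    {x : ι → L} {y : κ → L}
    (hX : ∀ i, algebraMap (MvPolynomial ι k) L (X i) = x i)
    (hxy : AlgebraicIndependent k (Sum.elim y x)) : AlgebraicIndependent K y := by
  have hyR : AlgebraicIndependent (MvPolynomial ι k) y := by
    let φ : MvPolynomial κ (MvPolynomial ι k) →ₐ[MvPolynomial ι k] L := aeval y
    have h : aeval (Sum.elim y x) =
        (φ.restrictScalars k).comp (sumAlgEquiv k κ ι).toAlgHom := by
      refine MvPolynomial.algHom_ext fun i => ?_
      rcases i with i | i
      · simp [φ]
      · simp [φ, hX]
    have h' : Function.Injective (aeval (R := k) (Sum.elim y x)) := hxy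
    rw [h] at h'
    exact (Function.Injective.of_comp_iff' _ (sumAlgEquiv k κ ι).bijective).1 h'
  have : Algebra.IsAlgebraic (MvPolynomial ι k) K :=
    IsLocalization.isAlgebraic K (nonZeroDivisors (MvPolynomial ι k))
  exact hyR.extendScalars K

theorem algebraMap_equivariant [Fintype ι] [DecidableEq ι] [Algebra k K]
    [IsFractionRing (MvPolynomial ι k) K] [IsScalarTower k (MvPolynomial ι k) K]
    [IsScalarTower k (MvPolynomial ι k) L] [IsScalarTower k K L]
    {ρ : G →* Matrix ι ι k} {aK : G →* (K ≃ₐ[k] K)}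
    (haK : ∀ g i, aK g (algebraMap (MvPolynomial ι k) K (X i)) =
      algebraMap (MvPolynomial ι k) K (∑ j, ρ g⁻¹ i j • X j))
    {aL : G →* (L ≃ₐ[k] L)} {x : ι → L}
    (hX : ∀ i, algebraMap (MvPolynomial ι k) L (X i) = x i)
    (hx : ∀ g i, aL g (x i) = ∑ j, ρ g⁻¹ i j • x j) (g : G) (c : K) :
    aL g (algebraMap K L c) = algebraMap K L (aK g c) := by
  have key (p : MvPolynomial ι k) : aL g (algebraMap (MvPolynomial ι k) L p) =
      algebraMap K L (aK g (algebraMap (MvPolynomial ι k) K p)) := by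
    have h : (aL g).toAlgHom.comp (IsScalarTower.toAlgHom k (MvPolynomial ι k) L) =
        ((IsScalarTower.toAlgHom k K L).comp (aK g).toAlgHom).comp
          (IsScalarTower.toAlgHom k (MvPolynomial ι k) K) := by
      refine MvPolynomial.algHom_ext fun i => ?_
      change aL g (algebraMap (MvPolynomial ι k) L (X i)) =
        algebraMap K L (aK g (algebraMap (MvPolynomial ι k) K (X i)))
      rw [hX, hx, haK, ← IsScalarTower.algebraMap_apply, map_sum]
      refine Finset.sum_congr rfl fun j _ => ?_
      rw [← hX j]
      exact (map_smul (IsScalarTower.toAlgHom k (MvPolynomial ι k) L) _ _).symm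
    exact DFunLike.congr_fun h p
  obtain ⟨p, q, -, rfl⟩ := IsFractionRing.div_surjective (A := MvPolynomial ι k) c
  simp only [map_div₀, ← key, ← IsScalarTower.algebraMap_apply]

variable (K) in
theorem adjoin_eq_top_of_adjoin_sumElim [Algebra k K] [IsScalarTower k K L] {x : ι → L} {y : κ → L}
    (hX : ∀ i, algebraMap (MvPolynomial ι k) L (X i) = x i)
    (hgen : IntermediateField.adjoin k (Set.range (Sum.elim y x)) = ⊤) :
    IntermediateField.adjoin K (Set.range y) = ⊤ := by
  have hle : IntermediateField.adjoin k (Set.range (Sum.elim y x)) ≤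
      (IntermediateField.adjoin K (Set.range y)).restrictScalars k := by
    rw [IntermediateField.adjoin_le_iff]
    rintro _ ⟨i | i, rfl⟩
    · exact IntermediateField.subset_adjoin K (Set.range y) ⟨i, rfl⟩
    · rw [Sum.elim_inr, ← hX i, IsScalarTower.algebraMap_apply (MvPolynomial ι k) K L]
      exact IntermediateField.algebraMap_mem (IntermediateField.adjoin K (Set.range y)) _
  rw [hgen] at hle
  exact eq_top_iff.2 fun c _ => hle (IntermediateField.mem_top (x := c))

end Generic

/-- The no-name lemma for a field generated by two algebraically independent families, the first
carrying a faithful representation and the second an arbitrary one. -/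
theorem nonempty_fractionRing_fixedField_algEquiv [Finite G] [Fintype ι] [Fintype κ]
    [DecidableEq ι] [DecidableEq κ]
    (ρ : G →* Matrix ι ι k) (hρ : Function.Injective ρ) (σ : G →* Matrix κ κ k)
    (aK : G →* (FractionRing (MvPolynomial ι k) ≃ₐ[k] FractionRing (MvPolynomial ι k)))
    (haK : ∀ g i, aK g (algebraMap (MvPolynomial ι k) _ (X i)) =
      algebraMap (MvPolynomial ι k) _ (∑ j, ρ g⁻¹ i j • X j))
    (aL : G →* (L ≃ₐ[k] L)) (x : ι → L) (y : κ → L)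
    (hxy : AlgebraicIndependent k (Sum.elim y x))
    (hgen : IntermediateField.adjoin k (Set.range (Sum.elim y x)) = ⊤)
    (hx : ∀ g i, aL g (x i) = ∑ j, ρ g⁻¹ i j • x j)
    (hy : ∀ g i, aL g (y i) = ∑ j, σ g⁻¹ i j • y j) :
    Nonempty (FractionRing (MvPolynomial κ (IntermediateField.fixedField aK.range)) ≃ₐ[k]
      IntermediateField.fixedField aL.range) := by
  have hxi : AlgebraicIndependent k x := (AlgebraicIndependent.sumElim_iff.1 hxy).1
  let : Algebra (MvPolynomial ι k) L := (aeval x).toAlgebra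
  have : IsScalarTower k (MvPolynomial ι k) L := .of_algHom (aeval x)
  have : FaithfulSMul (MvPolynomial ι k) L := (faithfulSMul_iff_algebraMap_injective _ _).2 hxi
  let : Algebra (FractionRing (MvPolynomial ι k)) L := FractionRing.liftAlgebra _ _
  have : IsScalarTower k (FractionRing (MvPolynomial ι k)) L := by
    refine .of_algebraMap_eq fun c => ?_
    rw [IsScalarTower.algebraMap_apply k (MvPolynomial ι k) (FractionRing (MvPolynomial ι k)),
      ← IsScalarTower.algebraMap_apply (MvPolynomial ι k) (FractionRing (MvPolynomial ι k)) L,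
      ← IsScalarTower.algebraMap_apply]
  have hX (i : ι) : algebraMap (MvPolynomial ι k) L (X i) = x i := aeval_X x i
  exact nonempty_fractionRing_algEquiv_fixedField aK (injective_of_action_X hρ haK) aL
    (algebraMap_equivariant haK hX hx) (hxy.fractionField_of_sumElim _ hX)
    (adjoin_eq_top_of_adjoin_sumElim _ hX hgen) σ hy

end RationalFunctions

/-- **Speiser's lemma / no-name lemma for finite groups.**
Let `k` be a field of characteristic zero and `G` a finite group.  Let `V = k^n` and
`W = k^m` be two faithful linear representations of `G`, given by injective homomorphisms
`ρV : G →* GLₙ(k)` and `ρW : G →* GLₘ(k)`, and let `aV`, `aW` be the induced actions of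
`G` on the rational function fields `k(V) = Frac(k[x₁,…,xₙ])` and `k(W)` (quantified
together with the compatibility conditions that pin them down uniquely).  Then the
invariant fields `k(V)^G` and `k(W)^G` are stably equivalent over `k`: for some `r`, `s`,
the fields `k(V)^G(t₁,…,t_r)` and `k(W)^G(t₁,…,t_s)` are `k`-isomorphic. -/
theorem invariant_fields_of_faithful_representations_stably_equivalent
    (k : Type) [Field k] [CharZero k]
    (G : Type) [Group G] [Finite G]
    (n m : ℕ)
    (ρV : G →* Matrix.GeneralLinearGroup (Fin n) k) (hρV : Function.Injective ρV)
    (ρW : G →* Matrix.GeneralLinearGroup (Fin m) k) (hρW : Function.Injective ρW)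
    (aV : G →* (FractionRing (MvPolynomial (Fin n) k) ≃ₐ[k]
      FractionRing (MvPolynomial (Fin n) k)))
    (haV : ∀ (g : G) (i : Fin n),
      aV g (algebraMap (MvPolynomial (Fin n) k) (FractionRing (MvPolynomial (Fin n) k)) (X i)) =
        algebraMap (MvPolynomial (Fin n) k) (FractionRing (MvPolynomial (Fin n) k))
          (∑ j, ((ρV g⁻¹ : Matrix (Fin n) (Fin n) k) i j) • X j))
    (aW : G →* (FractionRing (MvPolynomial (Fin m) k) ≃ₐ[k]
      FractionRing (MvPolynomial (Fin m) k)))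
    (haW : ∀ (g : G) (i : Fin m),
      aW g (algebraMap (MvPolynomial (Fin m) k) (FractionRing (MvPolynomial (Fin m) k)) (X i)) =
        algebraMap (MvPolynomial (Fin m) k) (FractionRing (MvPolynomial (Fin m) k))
          (∑ j, ((ρW g⁻¹ : Matrix (Fin m) (Fin m) k) i j) • X j)) :
    ∃ r s : ℕ, Nonempty
      (FractionRing (MvPolynomial (Fin r) (IntermediateField.fixedField aV.range)) ≃ₐ[k]
       FractionRing (MvPolynomial (Fin s) (IntermediateField.fixedField aW.range))) := by
  let ρ : G →* Matrix (Fin n) (Fin n) k := (Units.coeHom _).comp ρV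
  let σ : G →* Matrix (Fin m) (Fin m) k := (Units.coeHom _).comp ρW
  have hρ : Function.Injective ρ := Units.val_injective.comp hρV
  have hσ : Function.Injective σ := Units.val_injective.comp hρW
  let τ : G →* Matrix (Fin m ⊕ Fin n) (Fin m ⊕ Fin n) k :=
    { toFun := fun g => Matrix.fromBlocks (σ g) 0 0 (ρ g)
      map_one' := by simp [Matrix.fromBlocks_one]
      map_mul' := fun g h => by simp [Matrix.fromBlocks_multiply] }
  obtain ⟨aL, haL⟩ := exists_linear_action τ
  let z (i : Fin m ⊕ Fin n) : FractionRing (MvPolynomial (Fin m ⊕ Fin n) k) :=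
    algebraMap (MvPolynomial (Fin m ⊕ Fin n) k) _ (X i)
  have hz : AlgebraicIndependent k z :=
    (algebraicIndependent_X _ k).map' (f := IsScalarTower.toAlgHom k _ _)
      (IsFractionRing.injective _ _)
  have hzgen : IntermediateField.adjoin k (Set.range z) = ⊤ := by
    refine eq_top_iff.2 fun c _ => ?_
    rw [IntermediateField.mem_adjoin_range_iff]
    obtain ⟨p, q, -, rfl⟩ := IsFractionRing.div_surjective (A := MvPolynomial (Fin m ⊕ Fin n) k) c
    have h : aeval z = IsScalarTower.toAlgHom k (MvPolynomial (Fin m ⊕ Fin n) k) _ :=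
      MvPolynomial.algHom_ext fun i => by simp [z]
    exact ⟨p, q, by rw [h]; rfl⟩
  have hx (g : G) (i : Fin n) : aL g (z (.inr i)) = ∑ j, ρ g⁻¹ i j • z (.inr j) := by
    simpa [τ] using haL g (.inr i)
  have hy (g : G) (i : Fin m) : aL g (z (.inl i)) = ∑ j, σ g⁻¹ i j • z (.inl j) := by
    simpa [τ] using haL g (.inl i)
  have hzV : Sum.elim (z ∘ Sum.inl) (z ∘ Sum.inr) = z := Sum.elim_comp_inl_inr z
  have hzW : Sum.elim (z ∘ Sum.inr) (z ∘ Sum.inl) = z ∘ Equiv.sumComm (Fin n) (Fin m) := by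
    ext (i | i) <;> rfl
  obtain ⟨eV⟩ := nonempty_fractionRing_fixedField_algEquiv ρ hρ σ aV haV aL
    (z ∘ Sum.inr) (z ∘ Sum.inl) (by rwa [hzV]) (by rwa [hzV]) hx hy
  obtain ⟨eW⟩ := nonempty_fractionRing_fixedField_algEquiv σ hσ ρ aW haW aL
    (z ∘ Sum.inl) (z ∘ Sum.inr) (by rw [hzW]; exact hz.comp _ (Equiv.sumComm _ _).injective)
    (by rwa [hzW, (Equiv.sumComm (Fin n) (Fin m)).surjective.range_comp]) hy hx
  exact ⟨m, n, ⟨eV.trans eW.symm⟩⟩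
end

section
/- Let k be a field of characteristic zero, G a finite group, V a faithful finite-dimensional linear representation of G over k, and W any finite-dimensional linear representation of G over k. Then, for the diagonal action of G on V ⊕ W, the field k(V ⊕ W)^G is purely transcendental over k(V)^G of transcendence degree equal to dim W. -/
open MvPolynomial

set_option synthInstance.maxHeartbeats 1000000
set_option maxHeartbeats 1000000

open scoped Classical in
theorem exists_sum_mul_ne_zero {G K L : Type*} [Fintype G] [Field K] [Field L] (f : G → K →* L)
    (hf : Function.Injective f) (c : G → L) {g₀ : G} (hc : c g₀ ≠ 0) :
    ∃ a : K, ∑ g, c g * f g a ≠ 0 := by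
  by_contra! h
  have hli := (linearIndependent_monoidHom K L).comp f hf
  refine hc (Fintype.linearIndependent_iff.1 hli c ?_ g₀)
  ext a
  simpa using h a

theorem exists_isUnit_matrix_map_mul_eq {k K G : Type*} [Field k] [Field K] [Algebra k K] [Group G]
    [Finite G] {m : ℕ} (σ : G →* (K ≃ₐ[k] K)) (hσ : Function.Injective σ)
    (ρ : G →* Matrix.GeneralLinearGroup (Fin m) k) :
    ∃ C : Matrix (Fin m) (Fin m) K, IsUnit C ∧
      ∀ g, C.map (σ g) * (ρ g⁻¹ : Matrix (Fin m) (Fin m) k).map (algebraMap k K) = C := by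
  cases nonempty_fintype G
  let A : G → Matrix (Fin m) (Fin m) K :=
    fun g ↦ (ρ g⁻¹ : Matrix (Fin m) (Fin m) k).map (algebraMap k K)
  have hA : ∀ g h, A h * A g = A (g * h) := fun g h ↦ by
    simp only [A, ← Matrix.map_mul, ← Units.val_mul, ← map_mul, mul_inv_rev]
  let r : K × Fin m → Fin m → K := fun p j ↦ ∑ g, σ g p.1 * A g p.2 j
  have hr : ∀ p g, Matrix.vecMul (fun j ↦ σ g (r p j)) (A g) = r p := by
    intro p g
    ext j
    simp only [r, Matrix.vecMul, dotProduct, map_sum, map_mul, Finset.sum_mul]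
    rw [Finset.sum_comm]
    refine Fintype.sum_equiv (Equiv.mulLeft g) _ _ fun h ↦ ?_
    simp only [Equiv.coe_mulLeft, ← hA g h, Matrix.mul_apply, Finset.mul_sum, map_mul,
      AlgEquiv.mul_apply, mul_assoc]
    simp [A]
  have hspan : Submodule.span K (Set.range r) = ⊤ := by
    by_contra hne
    obtain ⟨f, hf, hle⟩ := Submodule.exists_le_ker_of_lt_top _ (lt_top_iff_ne_top.2 hne)
    refine hf (LinearMap.pi_ext' fun i ↦ LinearMap.ext_ring ?_)
    by_contra hi
    obtain ⟨a, ha⟩ := exists_sum_mul_ne_zero (fun g ↦ ((σ g : K →+* K) : K →* K))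
      (fun g h hgh ↦ hσ (AlgEquiv.ext fun x ↦ DFunLike.congr_fun hgh x))
      (fun g ↦ f (A g i)) (g₀ := 1) (by
        have : A 1 i = Pi.single i 1 := by
          ext j
          simp [A, Matrix.one_apply, Pi.single_apply, eq_comm]
        simpa [this] using hi)
    apply ha
    have h0 : f (r (a, i)) = 0 := hle (Submodule.subset_span ⟨_, rfl⟩)
    have h1 : r (a, i) = ∑ g, σ g a • A g i := by
      funext j
      rw [Finset.sum_apply]
      rfl
    rw [h1, map_sum] at h0
    simpa [mul_comm] using h0
  have hfr : Module.finrank K (Submodule.span K (Set.range r)) = m := by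
    rw [hspan, finrank_top, Module.finrank_fin_fun]
  have hb := Submodule.exists_fun_fin_finrank_span_eq K (Set.range r)
  rw [hfr] at hb
  obtain ⟨C, hC, -, hli⟩ := hb
  refine ⟨Matrix.of C, Matrix.linearIndependent_rows_iff_isUnit.1 hli, fun g ↦ ?_⟩
  ext i j
  obtain ⟨p, hp⟩ := hC i
  have := congrFun (hr p g) j
  rw [hp] at this
  exact this

theorem AlgebraicIndependent.sum_smul_of_isUnit {K L : Type*} [Field K] [CommRing L] [Algebra K L]
    {m : ℕ} {w : Fin m → L} (hw : AlgebraicIndependent K w) {C : Matrix (Fin m) (Fin m) K}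
    (hC : IsUnit C) : AlgebraicIndependent K fun i ↦ ∑ j, C i j • w j := by
  have hC' : IsUnit C.det := (Matrix.isUnit_iff_isUnit_det C).1 hC
  let s : MvPolynomial (Fin m) K →ₐ[K] MvPolynomial (Fin m) K :=
    aeval fun i ↦ ∑ j, C i j • X j
  let t : MvPolynomial (Fin m) K →ₐ[K] MvPolynomial (Fin m) K :=
    aeval fun i ↦ ∑ j, C⁻¹ i j • X j
  have hts : t.comp s = AlgHom.id K _ := by
    ext1 i
    have h : ∀ l, ∑ j, C i j * C⁻¹ j l = if i = l then 1 else 0 := fun l ↦ by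
      rw [← Matrix.mul_apply, Matrix.mul_nonsing_inv C hC', Matrix.one_apply]
    simp only [s, t, AlgHom.comp_apply, aeval_X, map_sum, map_smul, Finset.smul_sum, smul_smul]
    rw [Finset.sum_comm]
    simp [← Finset.sum_smul, h]
  have hs : Function.Injective s := fun x y hxy ↦ by
    simpa [← AlgHom.comp_apply, hts] using congrArg t hxy
  have : (aeval fun i ↦ ∑ j, C i j • w j) = (aeval w : _ →ₐ[K] L).comp s := by
    ext; simp [s]
  rw [AlgebraicIndependent, this, AlgHom.coe_comp]
  exact Function.Injective.comp hw hs

theorem span_sum_smul_of_isUnit {K L : Type*} [Field K] [CommRing L] [Algebra K L]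
    {m : ℕ} {w : Fin m → L} {C : Matrix (Fin m) (Fin m) K} (hC : IsUnit C) (i : Fin m) :
    w i ∈ Submodule.span K (Set.range fun i ↦ ∑ j, C i j • w j) := by
  have hC' : IsUnit C.det := (Matrix.isUnit_iff_isUnit_det C).1 hC
  have h : ∀ l, ∑ j, C⁻¹ i j * C j l = if i = l then 1 else 0 := fun l ↦ by
    rw [← Matrix.mul_apply, Matrix.nonsing_inv_mul C hC', Matrix.one_apply]
  have : w i = ∑ j, C⁻¹ i j • ∑ l, C j l • w l := by
    simp only [Finset.smul_sum, smul_smul]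
    rw [Finset.sum_comm]
    simp [← Finset.sum_smul, h]
  rw [this]
  exact Submodule.sum_mem _ fun j _ ↦ Submodule.smul_mem _ _ (Submodule.subset_span ⟨j, rfl⟩)

theorem sum_apply_mem_range_aeval {k K L G : Type*} [Field k] [Field K] [Field L] [Algebra k K]
    [Algebra k L] [Algebra K L] [Group G] [Fintype G]
    {τ : Type*} (a : G →* (K ≃ₐ[k] K)) (b : G →* (L ≃ₐ[k] L))
    (hab : ∀ g x, b g (algebraMap K L x) = algebraMap K L (a g x))
    {y : τ → L} (hy : ∀ g i, b g (y i) = y i) {p : L} (hp : p ∈ Algebra.adjoin K (Set.range y)) :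
    ∃ P : MvPolynomial τ (IntermediateField.fixedField a.range), aeval y P = ∑ g, b g p := by
  rw [Algebra.adjoin_range_eq_range_aeval] at hp
  obtain ⟨P, rfl⟩ := hp
  induction P using MvPolynomial.induction_on' with
  | monomial s c =>
    have hc : ∑ g, a g c ∈ IntermediateField.fixedField a.range := by
      rintro ⟨_, h, rfl⟩
      change a h _ = _
      rw [map_sum]
      exact Fintype.sum_equiv (Equiv.mulLeft h) _ _ fun g ↦ by simp
    refine ⟨monomial s ⟨_, hc⟩, ?_⟩
    have hc' : algebraMap (IntermediateField.fixedField a.range) L ⟨_, hc⟩ =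
        ∑ g, algebraMap K L (a g c) := by
      rw [← map_sum]; rfl
    simp [aeval_monomial, Finsupp.prod, hab, hy, hc', Finset.sum_mul]
  | add P Q hP hQ =>
    obtain ⟨P', hP'⟩ := hP
    obtain ⟨Q', hQ'⟩ := hQ
    exact ⟨P' + Q', by simp_all [Finset.sum_add_distrib]⟩

theorem exists_algEquiv_fixedField_fractionRing {k K L G : Type*} [Field k] [Field K] [Field L]
    [Algebra k K] [Algebra k L] [Algebra K L] [IsScalarTower k K L] [Group G] [Finite G]
    {τ : Type*} (a : G →* (K ≃ₐ[k] K)) (ha : Function.Injective a) (b : G →* (L ≃ₐ[k] L))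
    (hab : ∀ g x, b g (algebraMap K L x) = algebraMap K L (a g x))
    {y : τ → L} (hy : ∀ g i, b g (y i) = y i) (hind : AlgebraicIndependent K y)
    (hgen : ∀ z : L, ∃ p ∈ Algebra.adjoin K (Set.range y), ∃ q ∈ Algebra.adjoin K (Set.range y),
      q ≠ 0 ∧ z * q = p) :
    ∃ e : IntermediateField.fixedField b.range ≃ₐ[k]
        FractionRing (MvPolynomial τ (IntermediateField.fixedField a.range)),
      ∀ (z : IntermediateField.fixedField b.range) (x : IntermediateField.fixedField a.range),
        (z : L) = algebraMap K L x → e z = algebraMap _ _ x := by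
  cases nonempty_fintype G
  let F := IntermediateField.fixedField a.range
  have hF : AlgebraicIndependent F y := hind.restrictScalars (algebraMap F K).injective
  let f : MvPolynomial τ F →ₐ[k] L := (aeval y : MvPolynomial τ F →ₐ[F] L).restrictScalars k
  have hf : Function.Injective f := hF
  let Φ : FractionRing (MvPolynomial τ F) →ₐ[k] L := IsFractionRing.liftAlgHom hf
  have hΦ : ∀ P, Φ (algebraMap _ _ P) = aeval y P := fun P ↦ IsFractionRing.lift_algebraMap hf P
  have hbf : ∀ g (P : MvPolynomial τ F), b g (aeval y P) = aeval y P := by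
    intro g P
    induction P using MvPolynomial.induction_on with
    | C c =>
      have hc : a g (c : K) = c := c.2 ⟨a g, g, rfl⟩
      rw [aeval_C, IsScalarTower.algebraMap_apply F K L]
      exact (hab g c).trans (congrArg _ hc)
    | add P Q hP hQ => simp [hP, hQ]
    | mul_X P i hP => simp [hP, hy]
  have hrange : Φ.fieldRange = IntermediateField.fixedField b.range := by
    apply le_antisymm
    · rintro _ ⟨x, rfl⟩ ⟨_, g, rfl⟩
      obtain ⟨P, Q, -, rfl⟩ := IsFractionRing.div_surjective (A := MvPolynomial τ F) x
      change b g (Φ _) = Φ _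
      rw [map_div₀, map_div₀, hΦ, hΦ, hbf, hbf]
    · intro z hz
      have hz' : ∀ g, b g z = z := fun g ↦ hz ⟨b g, g, rfl⟩
      obtain ⟨p, hp, q, hq, hq0, hzq⟩ := hgen z
      obtain ⟨c, hc⟩ := exists_sum_mul_ne_zero
        (fun g ↦ (((algebraMap K L).comp (a g : K →+* K) : K →+* L) : K →* L))
        (fun g h hgh ↦ ha (AlgEquiv.ext fun x ↦
          (algebraMap K L).injective (DFunLike.congr_fun hgh x)))
        (fun g ↦ b g q) (g₀ := 1) (by simpa using hq0)
      have hcm : algebraMap K L c ∈ Algebra.adjoin K (Set.range y) := Subalgebra.algebraMap_mem _ c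
      obtain ⟨P, hP⟩ := sum_apply_mem_range_aeval a b hab hy (mul_mem hp hcm)
      obtain ⟨Q, hQ⟩ := sum_apply_mem_range_aeval a b hab hy (mul_mem hq hcm)
      have hQ0 : aeval y Q ≠ 0 := by
        rw [hQ]
        simpa [hab] using hc
      refine ⟨algebraMap _ _ P / algebraMap _ _ Q, ?_⟩
      change Φ _ = z
      rw [map_div₀, hΦ, hΦ, div_eq_iff hQ0, hP, hQ, ← hzq, Finset.mul_sum]
      simp [hz', mul_assoc]
  let e := (AlgEquiv.ofInjectiveField Φ).trans (IntermediateField.equivOfEq hrange)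
  refine ⟨e.symm, fun z x hzx ↦ ?_⟩
  rw [AlgEquiv.symm_apply_eq]
  ext
  rw [hzx]
  change _ = Φ _
  rw [IsScalarTower.algebraMap_apply F (MvPolynomial τ F), hΦ, algebraMap_eq, aeval_C]
  rfl

theorem algebraicIndependent_X_inr {k σ τ : Type*} [Field k]
    [Algebra (FractionRing (MvPolynomial σ k)) (FractionRing (MvPolynomial (σ ⊕ τ) k))]
    [IsScalarTower k (FractionRing (MvPolynomial σ k)) (FractionRing (MvPolynomial (σ ⊕ τ) k))]
    (h : ∀ i, algebraMap (FractionRing (MvPolynomial σ k)) (FractionRing (MvPolynomial (σ ⊕ τ) k))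
      (algebraMap (MvPolynomial σ k) _ (X i)) =
        algebraMap (MvPolynomial (σ ⊕ τ) k) _ (X (Sum.inl i))) :
    AlgebraicIndependent (FractionRing (MvPolynomial σ k)) fun i : τ ↦
      algebraMap (MvPolynomial (σ ⊕ τ) k) (FractionRing (MvPolynomial (σ ⊕ τ) k))
        (X (Sum.inr i)) := by
  let R := MvPolynomial σ k
  let B := MvPolynomial (σ ⊕ τ) k
  let K := FractionRing R
  let L := FractionRing B
  let : Algebra R L := ((algebraMap K L).comp (algebraMap R K)).toAlgebra
  have : IsScalarTower R K L := .of_algebraMap_eq fun _ ↦ rfl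
  have : IsScalarTower k R L := .of_algebraMap_eq fun x ↦ by
    rw [IsScalarTower.algebraMap_apply R K L, ← IsScalarTower.algebraMap_apply k R K,
      ← IsScalarTower.algebraMap_apply k K L]
  have : Algebra.IsAlgebraic R K := 
    (IsFractionRing.comap_isAlgebraic_iff (K := K)).mpr inferInstance
  refine AlgebraicIndependent.extendScalars (R := R) K ?_
  let E : B ≃ₐ[k] MvPolynomial τ R := (renameEquiv k (Equiv.sumComm σ τ)).trans (sumAlgEquiv k τ σ)
  have hE : ((aeval fun i : τ ↦ algebraMap B L (X (Sum.inr i)) :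
      MvPolynomial τ R →ₐ[R] L).restrictScalars k).comp E.toAlgHom =
      IsScalarTower.toAlgHom k B L := by
    ext i
    rcases i with i | i
    · have hi : E (X (Sum.inl i)) = C (X i) :=
        (congrArg (sumAlgEquiv k τ σ) (rename_X _ _)).trans (sumAlgEquiv_X_inr k τ σ i)
      change aeval _ (E (X (Sum.inl i))) = _
      rw [hi, aeval_C]
      exact h i
    · have hi : E (X (Sum.inr i)) = X i :=
        (congrArg (sumAlgEquiv k τ σ) (rename_X _ _)).trans (sumAlgEquiv_X_inl k τ σ i)
      change aeval _ (E (X (Sum.inr i))) = _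
      rw [hi, aeval_X]
      rfl
  intro P Q hPQ
  obtain ⟨P, rfl⟩ := E.surjective P
  obtain ⟨Q, rfl⟩ := E.surjective Q
  congr 1
  apply IsFractionRing.injective B L
  have hP := DFunLike.congr_fun hE P
  have hQ := DFunLike.congr_fun hE Q
  exact hP.symm.trans (hPQ.trans hQ)

/-- Let `k` be a field of characteristic zero, `G` a finite group,
`V = k^n` a faithful linear representation of `G` and `W = k^m` any linear representation
of `G`.  Consider the diagonal action of `G` on `V ⊕ W` (variables indexed by
`Fin n ⊕ Fin m`), the induced actions `aV` on `k(V)` and `aB` on `k(V ⊕ W)`, and the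
natural `G`-equivariant inclusion `ι : k(V) → k(V ⊕ W)`.  Then `k(V ⊕ W)^G` is purely
transcendental over `k(V)^G` of transcendence degree `m = dim W`: there is a
`k`-isomorphism of `k(V ⊕ W)^G` with the rational function field in `m` variables over
`k(V)^G`, restricting to the canonical inclusion on (the image under `ι` of)
`k(V)^G`. -/
theorem invariant_field_of_direct_sum_pure_over_invariant_field
    (k : Type) [Field k] [CharZero k]
    (G : Type) [Group G] [Finite G]
    (n m : ℕ)
    (ρV : G →* Matrix.GeneralLinearGroup (Fin n) k) (hρV : Function.Injective ρV)
    (ρW : G →* Matrix.GeneralLinearGroup (Fin m) k)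
    (aV : G →* (FractionRing (MvPolynomial (Fin n) k) ≃ₐ[k]
      FractionRing (MvPolynomial (Fin n) k)))
    (haV : ∀ (g : G) (i : Fin n),
      aV g (algebraMap (MvPolynomial (Fin n) k) (FractionRing (MvPolynomial (Fin n) k)) (X i)) =
        algebraMap (MvPolynomial (Fin n) k) (FractionRing (MvPolynomial (Fin n) k))
          (∑ j, ((ρV g⁻¹ : Matrix (Fin n) (Fin n) k) i j) • X j))
    (aB : G →* (FractionRing (MvPolynomial (Fin n ⊕ Fin m) k) ≃ₐ[k]
      FractionRing (MvPolynomial (Fin n ⊕ Fin m) k)))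
    (haBV : ∀ (g : G) (i : Fin n),
      aB g (algebraMap (MvPolynomial (Fin n ⊕ Fin m) k)
          (FractionRing (MvPolynomial (Fin n ⊕ Fin m) k)) (X (Sum.inl i))) =
        algebraMap (MvPolynomial (Fin n ⊕ Fin m) k)
          (FractionRing (MvPolynomial (Fin n ⊕ Fin m) k))
          (∑ j, ((ρV g⁻¹ : Matrix (Fin n) (Fin n) k) i j) • X (Sum.inl j)))
    (haBW : ∀ (g : G) (i : Fin m),
      aB g (algebraMap (MvPolynomial (Fin n ⊕ Fin m) k)
          (FractionRing (MvPolynomial (Fin n ⊕ Fin m) k)) (X (Sum.inr i))) =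
        algebraMap (MvPolynomial (Fin n ⊕ Fin m) k)
          (FractionRing (MvPolynomial (Fin n ⊕ Fin m) k))
          (∑ j, ((ρW g⁻¹ : Matrix (Fin m) (Fin m) k) i j) • X (Sum.inr j)))
    (ι : FractionRing (MvPolynomial (Fin n) k) →ₐ[k]
      FractionRing (MvPolynomial (Fin n ⊕ Fin m) k))
    (hι : ∀ i : Fin n,
      ι (algebraMap (MvPolynomial (Fin n) k) (FractionRing (MvPolynomial (Fin n) k)) (X i)) =
        algebraMap (MvPolynomial (Fin n ⊕ Fin m) k)
          (FractionRing (MvPolynomial (Fin n ⊕ Fin m) k)) (X (Sum.inl i)))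
    (hιequiv : ∀ (g : G) (x : FractionRing (MvPolynomial (Fin n) k)),
      ι (aV g x) = aB g (ι x)) :
    ∃ e : (IntermediateField.fixedField aB.range) ≃ₐ[k]
        FractionRing (MvPolynomial (Fin m) (IntermediateField.fixedField aV.range)),
      ∀ (y : IntermediateField.fixedField aB.range)
        (x : IntermediateField.fixedField aV.range),
        (y : FractionRing (MvPolynomial (Fin n ⊕ Fin m) k)) =
            ι (x : FractionRing (MvPolynomial (Fin n) k)) →
          e y = algebraMap (IntermediateField.fixedField aV.range)
            (FractionRing (MvPolynomial (Fin m) (IntermediateField.fixedField aV.range))) x := by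
  have hσ : Function.Injective aV := by
    intro g h hgh
    rw [← inv_inj]
    refine hρV (Units.ext (Matrix.ext fun i j ↦ ?_))
    have hX := (haV g i).symm.trans ((DFunLike.congr_fun hgh _).trans (haV h i))
    have hcoeff := congrArg (coeff (Finsupp.single j 1)) (IsFractionRing.injective _ _ hX)
    simpa [coeff_sum, coeff_X, Finsupp.single_left_inj] using hcoeff
  obtain ⟨C, hC, hCmul⟩ := exists_isUnit_matrix_map_mul_eq aV hσ ρW
  let : Algebra (FractionRing (MvPolynomial (Fin n) k))
    (FractionRing (MvPolynomial (Fin n ⊕ Fin m) k)) := ι.toRingHom.toAlgebra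
  have : IsScalarTower k (FractionRing (MvPolynomial (Fin n) k))
    (FractionRing (MvPolynomial (Fin n ⊕ Fin m) k)) := .of_algebraMap_eq fun x ↦ (ι.commutes x).symm
  have hind := (algebraicIndependent_X_inr (τ := Fin m) hι).sum_smul_of_isUnit hC
  refine exists_algEquiv_fixedField_fractionRing aV hσ aB (fun g x ↦ (hιequiv g x).symm)
    (fun g i ↦ ?_) hind fun z ↦ ?_
  · have hterm : ∀ j, aB g (C i j • algebraMap (MvPolynomial (Fin n ⊕ Fin m) k)
        (FractionRing (MvPolynomial (Fin n ⊕ Fin m) k)) (X (Sum.inr j))) =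
        ∑ l, (aV g (C i j) * algebraMap k _ ((ρW g⁻¹ : Matrix (Fin m) (Fin m) k) j l)) •
          algebraMap (MvPolynomial (Fin n ⊕ Fin m) k)
            (FractionRing (MvPolynomial (Fin n ⊕ Fin m) k)) (X (Sum.inr l)) := by
      intro j
      rw [Algebra.smul_def, map_mul, haBW, map_sum, Finset.mul_sum]
      refine Finset.sum_congr rfl fun l _ ↦ ?_
      rw [Algebra.smul_def, Algebra.smul_def, map_mul, map_mul, ← mul_assoc]
      congr 2
      · exact (hιequiv g _).symm
      · exact (ι.commutes _).symm
    rw [map_sum, Finset.sum_congr rfl fun j _ ↦ hterm j, Finset.sum_comm]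
    refine Finset.sum_congr rfl fun l _ ↦ ?_
    rw [← Finset.sum_smul]
    congr 1
    exact congrFun (congrFun (hCmul g) i) l
  · have hmem : ∀ P : MvPolynomial (Fin n ⊕ Fin m) k,
        algebraMap _ (FractionRing (MvPolynomial (Fin n ⊕ Fin m) k)) P ∈
          Algebra.adjoin (FractionRing (MvPolynomial (Fin n) k)) (Set.range fun i ↦ ∑ j, C i j •
            algebraMap (MvPolynomial (Fin n ⊕ Fin m) k)
              (FractionRing (MvPolynomial (Fin n ⊕ Fin m) k)) (X (Sum.inr j))) := by
      intro P
      induction P using MvPolynomial.induction_on with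
      | C c =>
        have hc : algebraMap _ (FractionRing (MvPolynomial (Fin n ⊕ Fin m) k))
            (MvPolynomial.C (σ := Fin n ⊕ Fin m) c) = ι (algebraMap k _ c) :=
          (ι.commutes c).symm
        rw [hc]
        exact Subalgebra.algebraMap_mem _ (algebraMap k _ c)
      | add P Q hP hQ => rw [map_add]; exact add_mem hP hQ
      | mul_X P i hP =>
        rw [map_mul]
        refine mul_mem hP ?_
        rcases i with i | i
        · rw [← hι]
          exact Subalgebra.algebraMap_mem _ (algebraMap _ (FractionRing _) (X i))
        · exact Algebra.span_le_adjoin _ _ (span_sum_smul_of_isUnit (w := fun j ↦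
            algebraMap (MvPolynomial (Fin n ⊕ Fin m) k)
              (FractionRing (MvPolynomial (Fin n ⊕ Fin m) k)) (X (Sum.inr j))) hC i)
    obtain ⟨P, Q, hQ, rfl⟩ := IsFractionRing.div_surjective
      (A := MvPolynomial (Fin n ⊕ Fin m) k) z
    have hQ0 : algebraMap _ (FractionRing (MvPolynomial (Fin n ⊕ Fin m) k)) Q ≠ 0 :=
      IsFractionRing.to_map_ne_zero_of_mem_nonZeroDivisors hQ
    exact ⟨_, hmem P, _, hmem Q, hQ0, div_mul_cancel₀ _ hQ0⟩
end

section
/- (Miyata's lemma.) Let K be a field and let a group G act on the polynomial ring K[t] by ring automorphisms such that the subring K ⊂ K[t] is globally stable under G (each g ∈ G maps K onto K). Extend the action to the rational function field K(t). Then there exists a G-invariant polynomial p ∈ K[t] such that the fixed field satisfies K(t)^G = K^G(p), i.e. the fixed field of K(t) is generated over the fixed field K^G by the single element p. -/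
open Polynomial in
/-- A ring endomorphism of `K[X]` that maps constants to constants multiplies degrees by the
degree of the image of `X`. -/
theorem natDegree_ringHom_apply_of_map_C {K : Type*} [Field K] (φ : K[X] →+* K[X])
    (hφ : ∀ c : K, ∃ c' : K, φ (C c) = C c') (q : K[X]) :
    (φ q).natDegree = q.natDegree * (φ X).natDegree := by
  let σ : K →+* K := constantCoeff.comp (φ.comp C)
  have hσ (c : K) : φ (C c) = C (σ c) := by
    obtain ⟨c', hc'⟩ := hφ c
    simp [σ, hc']
  have key : φ = (compRingHom (φ X)).comp (mapRingHom σ) :=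
    Polynomial.ringHom_ext (fun c => by simp [hσ]) (by simp)
  have hq : φ q = (q.map σ).comp (φ X) := by
    conv_lhs => rw [key]
    simp
  rw [hq, natDegree_comp, natDegree_map]

open Polynomial in
/-- If a degree-preserving ring endomorphism fixes the fraction `f / g`, it fixes the quotient of
the Euclidean division of `f` by `g`. -/
theorem map_div_eq_of_map_mul_eq {K : Type*} [Field K] (φ : K[X] →+* K[X])
    (hφ : ∀ q, (φ q).degree = q.degree) {f g : K[X]} (hg : g ≠ 0) (h : φ f * g = f * φ g) :
    φ (f / g) = f / g := by
  by_contra hne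
  have hsub : φ (f / g) - f / g ≠ 0 := sub_ne_zero.mpr hne
  have hdiv := EuclideanDomain.div_add_mod f g
  have hdiv' : φ g * φ (f / g) + φ (f % g) = φ f := by rw [← map_mul, ← map_add, hdiv]
  have hlt : (f % g).degree < g.degree := degree_mod_lt f hg
  have key : φ g * g * (φ (f / g) - f / g) = f % g * φ g - φ (f % g) * g := by
    linear_combination h + g * hdiv' - φ g * hdiv
  have hgbot : g.degree ≠ ⊥ := by simpa using hg
  have h1 : (f % g * φ g - φ (f % g) * g).degree < g.degree + g.degree := by
    refine (degree_sub_le _ _).trans_lt ?_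
    rw [degree_mul, degree_mul, hφ, hφ, max_self]
    exact WithBot.add_lt_add_right hgbot hlt
  have h2 : g.degree + g.degree ≤ (φ g * g * (φ (f / g) - f / g)).degree := by
    rw [degree_mul, degree_mul, hφ]
    exact le_add_of_nonneg_right (zero_le_degree_iff.mpr hsub)
  rw [key] at h2
  exact absurd h1 (not_lt.mpr h2)

open Polynomial in
/-- A subfield of `K(X)` containing all polynomials fixed by a family of degree-preserving
endomorphisms contains all fractions fixed by that family. -/
theorem div_mem_of_forall_fixed_mem {K ι : Type*} [Field K] (φ : ι → K[X] →+* K[X])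
    (hφ : ∀ i q, (φ i q).degree = q.degree) (L : Subfield (RatFunc K))
    (hL : ∀ q : K[X], (∀ i, φ i q = q) → algebraMap K[X] (RatFunc K) q ∈ L)
    (f g : K[X]) (hg : g ≠ 0) (h : ∀ i, φ i f * g = f * φ i g) :
    algebraMap K[X] (RatFunc K) f / algebraMap K[X] (RatFunc K) g ∈ L := by
  induction hn : g.natDegree using Nat.strong_induction_on generalizing f g with
  | _ n ih =>
    have hq (i : ι) : φ i (f / g) = f / g := map_div_eq_of_map_mul_eq (φ i) (hφ i) hg (h i)
    have hdiv := EuclideanDomain.div_add_mod f g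
    have hg' : algebraMap K[X] (RatFunc K) g ≠ 0 := RatFunc.algebraMap_ne_zero hg
    have hsplit : algebraMap K[X] (RatFunc K) f / algebraMap K[X] (RatFunc K) g =
        algebraMap K[X] (RatFunc K) (f / g) +
          (algebraMap K[X] (RatFunc K) g / algebraMap K[X] (RatFunc K) (f % g))⁻¹ := by
      rw [inv_div]
      conv_lhs => rw [← hdiv]
      rw [map_add, map_mul]
      field_simp
    rw [hsplit]
    refine L.add_mem (hL _ hq) (L.inv_mem ?_)
    by_cases hr : f % g = 0
    · simp [hr, L.zero_mem]
    · refine ih _ ?_ _ _ hr (fun i => ?_) rfl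
      · rw [← hn]
        exact natDegree_lt_natDegree hr (degree_mod_lt f hg)
      · have hdiv' : φ i g * (f / g) + φ i (f % g) = φ i f := by
          conv_lhs => rw [← hq i]
          rw [← map_mul, ← map_add, hdiv]
        linear_combination φ i g * hdiv - g * hdiv' - h i

open Polynomial in
/-- The polynomials fixed by a family of degree-preserving endomorphisms are generated over the
fixed constants by a single fixed polynomial. -/
theorem exists_fixed_forall_fixed_mem {K ι : Type*} [Field K] (φ : ι → K[X] →+* K[X])
    (hφ : ∀ i q, (φ i q).degree = q.degree) :
    ∃ p : K[X], (∀ i, φ i p = p) ∧ ∀ L : Subring K[X],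
      (∀ c : K, (∀ i, φ i (C c) = C c) → C c ∈ L) → p ∈ L →
        ∀ q : K[X], (∀ i, φ i q = q) → q ∈ L := by
  by_cases hex : ∃ p : K[X], (∀ i, φ i p = p) ∧ 0 < p.natDegree
  · let d := sInf (natDegree '' {p : K[X] | (∀ i, φ i p = p) ∧ 0 < p.natDegree})
    obtain ⟨p, ⟨hp, hp0⟩, hpd⟩ :
        d ∈ natDegree '' {p : K[X] | (∀ i, φ i p = p) ∧ 0 < p.natDegree} :=
      Nat.sInf_mem (Set.Nonempty.image _ hex)
    have hmin (q : K[X]) (hq : ∀ i, φ i q = q) (hlt : q.natDegree < p.natDegree) :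
        q.natDegree = 0 := by
      by_contra hne
      have : d ≤ q.natDegree := Nat.sInf_le ⟨q, ⟨hq, Nat.pos_of_ne_zero hne⟩, rfl⟩
      omega
    have hpne : p ≠ 0 := ne_zero_of_natDegree_gt hp0
    refine ⟨p, hp, fun L hC hpL q hq => ?_⟩
    induction hn : q.natDegree using Nat.strong_induction_on generalizing q with
    | _ n ih =>
      have hquo (i : ι) : φ i (q / p) = q / p :=
        map_div_eq_of_map_mul_eq (φ i) (hφ i) hpne (by rw [hq, hp])
      have hdiv := EuclideanDomain.div_add_mod q p
      have hrem (i : ι) : φ i (q % p) = q % p := by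
        have h := congrArg (φ i) hdiv
        rw [map_add, map_mul, hp, hquo, hq] at h
        exact add_left_cancel (h.trans hdiv.symm)
      have hlt : (q % p).natDegree < p.natDegree := natDegree_mod_lt q hp0.ne'
      have hremL : q % p ∈ L := by
        have hc := eq_C_of_natDegree_eq_zero (hmin _ hrem hlt)
        rw [hc]
        exact hC _ fun i => by rw [← hc, hrem]
      rw [← hdiv]
      refine L.add_mem (L.mul_mem hpL ?_) hremL
      by_cases hz : q / p = 0
      · rw [hz]
        exact L.zero_mem
      · have hq0 : q ≠ 0 := by
          rintro rfl
          simp at hz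
        refine ih _ ?_ _ hquo rfl
        rw [← hn]
        exact natDegree_lt_natDegree hz
          (degree_div_lt hq0 (natDegree_pos_iff_degree_pos.mp hp0))
  · refine ⟨0, fun i => map_zero _, fun L hC _ q hq => ?_⟩
    have hc := eq_C_of_natDegree_eq_zero (p := q) (by
      by_contra hne
      exact hex ⟨q, hq, Nat.pos_of_ne_zero hne⟩)
    rw [hc]
    exact hC _ fun i => by rw [← hc, hq]


/-- **Miyata's lemma.** Let `K` be a field and let a group `G` act on the
polynomial ring `K[t]` by ring automorphisms (an action `a`) such that the subring of
constants `K ⊂ K[t]` is globally stable under `G`.  Extend the action to the rational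
function field `K(t)` (an action `b` compatible with `a`).  Then there exists a
`G`-invariant polynomial `p ∈ K[t]` such that the fixed field of `K(t)` is generated
over the fixed field `K^G` by the single element `p`: `K(t)^G = K^G(p)`. -/
theorem miyata_invariant_field_generated_by_one_polynomial
    (K : Type*) [Field K] (G : Type*) [Group G]
    (a : G →* (Polynomial K ≃+* Polynomial K))
    (hK : ∀ (g : G) (c : K), ∃ c' : K, a g (Polynomial.C c) = Polynomial.C c')
    (b : G →* (RatFunc K ≃+* RatFunc K))
    (hb : ∀ (g : G) (q : Polynomial K),
      b g (algebraMap (Polynomial K) (RatFunc K) q) =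
        algebraMap (Polynomial K) (RatFunc K) (a g q)) :
    ∃ p : Polynomial K, (∀ g : G, a g p = p) ∧
      (Subfield.closure ((algebraMap (Polynomial K) (RatFunc K)) ''
          ({q : Polynomial K | (∃ c : K, q = Polynomial.C c) ∧ ∀ g : G, a g q = q}
            ∪ {p})) : Set (RatFunc K))
        = {x : RatFunc K | ∀ g : G, b g x = x} := by
  have hdeg (g : G) (q : Polynomial K) : (a g q).degree = q.degree := by
    have hmul (g : G) (q : Polynomial K) :
        (a g q).natDegree = q.natDegree * (a g Polynomial.X).natDegree :=
      natDegree_ringHom_apply_of_map_C (a g : Polynomial K →+* Polynomial K) (hK g) q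
    have hX : (a g Polynomial.X).natDegree = 1 := by
      have h := hmul g (a g⁻¹ Polynomial.X)
      rw [← RingAut.mul_apply, ← map_mul, mul_inv_cancel, map_one, RingAut.one_apply,
        Polynomial.natDegree_X] at h
      exact Nat.eq_one_of_mul_eq_one_left h.symm
    by_cases hq : q = 0
    · simp [hq]
    · rw [Polynomial.degree_eq_natDegree hq,
        Polynomial.degree_eq_natDegree ((map_ne_zero_iff _ (a g).injective).mpr hq), hmul, hX,
        mul_one]
  obtain ⟨p, hp, hgen⟩ :=
    exists_fixed_forall_fixed_mem (fun g => (a g : Polynomial K →+* Polynomial K)) hdeg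
  refine ⟨p, hp, Set.Subset.antisymm ?_ ?_⟩
  · intro x hx g
    have hle : Subfield.closure ((algebraMap (Polynomial K) (RatFunc K)) ''
        ({q : Polynomial K | (∃ c : K, q = Polynomial.C c) ∧ ∀ g : G, a g q = q} ∪ {p})) ≤
        RingHom.eqLocusField (b g : RatFunc K →+* RatFunc K) (RingHom.id _) := by
      rw [Subfield.closure_le]
      rintro _ ⟨q, ⟨-, hq⟩ | rfl, rfl⟩
      · exact (hb g q).trans (congrArg _ (hq g))
      · exact (hb g _).trans (congrArg _ (hp g))
    exact hle hx
  · intro x hx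
    set L := Subfield.closure ((algebraMap (Polynomial K) (RatFunc K)) ''
      ({q : Polynomial K | (∃ c : K, q = Polynomial.C c) ∧ ∀ g : G, a g q = q} ∪ {p}))
    have hpoly : ∀ q : Polynomial K, (∀ g, a g q = q) →
        algebraMap (Polynomial K) (RatFunc K) q ∈ L :=
      hgen (L.toSubring.comap (algebraMap (Polynomial K) (RatFunc K)))
        (fun c hc => Subfield.subset_closure ⟨_, Or.inl ⟨⟨c, rfl⟩, hc⟩, rfl⟩)
        (Subfield.subset_closure ⟨p, Or.inr rfl, rfl⟩)
    rw [← RatFunc.num_div_denom x]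
    refine div_mem_of_forall_fixed_mem (fun g => (a g : Polynomial K →+* Polynomial K)) hdeg L
      hpoly _ _ x.denom_ne_zero fun g => ?_
    have hfix := hx g
    have hd : algebraMap (Polynomial K) (RatFunc K) x.denom ≠ 0 :=
      RatFunc.algebraMap_ne_zero x.denom_ne_zero
    have hd' : algebraMap (Polynomial K) (RatFunc K) (a g x.denom) ≠ 0 :=
      RatFunc.algebraMap_ne_zero ((map_ne_zero_iff _ (a g).injective).mpr x.denom_ne_zero)
    rw [← RatFunc.num_div_denom x, map_div₀, hb, hb, div_eq_div_iff hd' hd, ← map_mul,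
      ← map_mul] at hfix
    exact RatFunc.algebraMap_injective K (by simpa using hfix)
end

section
/- (Miyata–Vinberg.) Let k be a field of characteristic zero, n ≥ 1, and let an abstract group G act linearly on k^n through a homomorphism G → GL_n(k) whose image consists of upper-triangular invertible matrices (equivalently, the action leaves a complete flag of subspaces invariant). Then the field of invariants k(x_1,…,x_n)^G of the induced action on the rational function field is purely transcendental over k. -/
namespace TriangularInvariants

section DegreePreserving

open Polynomial

variable {L F ι : Type*} [Field L] [Field F] [Algebra L F]

theorem div_mod_of_semiinvariant (Φ : L[X] →+* L[X]) (hΦ : ∀ p, (Φ p).degree = p.degree)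
    {p q : L[X]} (hq : q ≠ 0) {c : L} (hc : c ≠ 0) (hcp : Φ p = C c * p) (hcq : Φ q = C c * q) :
    Φ (p / q) = p / q ∧ Φ (p % q) = C c * (p % q) := by
  have hdiv : q * (p / q) + p % q = p := EuclideanDomain.div_add_mod p q
  have hCc : (C c : L[X]) ≠ 0 := C_ne_zero.mpr hc
  have hΦdiv : C c * q * Φ (p / q) + Φ (p % q) = C c * p := by
    rw [← hcq, ← map_mul, ← map_add, hdiv, hcp]
  have hrem : Φ (p % q) - C c * (p % q) = q * (C c * (p / q - Φ (p / q))) := by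
    linear_combination hΦdiv - C c * hdiv
  have hlt : (p % q).degree < q.degree := degree_mod_lt p hq
  have hzero : Φ (p % q) - C c * (p % q) = 0 := by
    refine eq_zero_of_dvd_of_degree_lt ⟨_, hrem⟩ ((degree_sub_le _ _).trans_lt (max_lt ?_ ?_))
    · rwa [hΦ]
    · rwa [degree_C_mul hc]
  refine ⟨?_, sub_eq_zero.mp hzero⟩
  rw [hzero] at hrem
  have := (mul_eq_zero.mp ((mul_eq_zero.mp hrem.symm).resolve_left hq)).resolve_left hCc
  exact (sub_eq_zero.mp this).symm

/-- A quotient of two polynomials which are semi-invariant with the same multiplier lies in the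
field generated by the invariant polynomials. -/
theorem aeval_div_aeval_mem_of_semiinvariant (Φ : ι → L[X] →+* L[X])
    (hΦ : ∀ i p, (Φ i p).degree = p.degree) (x : F) (M : Subfield F)
    (hM : ∀ p, (∀ i, Φ i p = p) → aeval x p ∈ M) (hx : Transcendental L x)
    {c : ι → L} (hc : ∀ i, c i ≠ 0) (p q : L[X]) (hq : q ≠ 0)
    (hcp : ∀ i, Φ i p = C (c i) * p) (hcq : ∀ i, Φ i q = C (c i) * q) :
    aeval x p / aeval x q ∈ M := by
  induction hn : q.degree using WellFoundedLT.induction generalizing p q with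
  | ind n ih =>
    subst hn
    have hstep := fun i ↦ div_mod_of_semiinvariant (Φ i) (hΦ i) hq (hc i) (hcp i) (hcq i)
    have hxq : aeval x q ≠ 0 := fun h ↦ hq ((transcendental_iff.mp hx) q h)
    have hdecomp : aeval x p / aeval x q = aeval x (p / q) + (aeval x q / aeval x (p % q))⁻¹ := by
      conv_lhs => rw [← EuclideanDomain.div_add_mod p q]
      rw [map_add, map_mul, inv_div]
      field_simp
    rw [hdecomp]
    refine M.add_mem (hM _ fun i ↦ (hstep i).1) (M.inv_mem ?_)
    rcases eq_or_ne (p % q) 0 with h0 | h0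
    · simp [h0]
    · exact ih _ (degree_mod_lt p hq) q (p % q) h0 hcq (fun i ↦ (hstep i).2) rfl

/-- The ring of invariant polynomials is generated over the invariant constants by an invariant
of minimal positive degree. -/
theorem aeval_mem_of_invariant_of_minimal_degree (Φ : ι → L[X] →+* L[X])
    (hΦ : ∀ i p, (Φ i p).degree = p.degree) (x : F) (M : Subfield F)
    (hconst : ∀ l, (∀ i, Φ i (C l) = C l) → algebraMap L F l ∈ M)
    {f : L[X]} (hf : ∀ i, Φ i f = f) (hfM : aeval x f ∈ M) (hf0 : 0 < f.degree)
    (hmin : ∀ p, (∀ i, Φ i p = p) → 0 < p.degree → f.degree ≤ p.degree)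
    (p : L[X]) (hp : ∀ i, Φ i p = p) : aeval x p ∈ M := by
  induction hn : p.degree using WellFoundedLT.induction generalizing p with
  | ind n ih =>
    subst hn
    rcases le_or_gt p.degree 0 with hle | hpos
    · rw [eq_C_of_degree_le_zero hle] at hp ⊢
      rw [aeval_C]
      exact hconst _ hp
    · have hfne : f ≠ 0 := ne_zero_of_degree_gt hf0
      have hpne : p ≠ 0 := ne_zero_of_degree_gt hpos
      have hstep := fun i ↦ div_mod_of_semiinvariant (Φ i) (hΦ i) hfne one_ne_zero
        (by simpa using hp i) (by simpa using hf i)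
      rw [← EuclideanDomain.div_add_mod p f, map_add, map_mul]
      refine M.add_mem (M.mul_mem hfM (ih _ ?_ _ (fun i ↦ (hstep i).1) rfl))
        (ih _ ((degree_mod_lt p hfne).trans_le (hmin p hp hpos)) _
          (fun i ↦ by simpa using (hstep i).2) rfl)
      exact degree_div_lt hpne hf0

theorem exists_semiinvariant_of_coprime (Φ : L[X] →+* L[X]) (hΦ : ∀ p, (Φ p).degree = p.degree)
    {p q : L[X]} (hq : q ≠ 0) (hpq : IsCoprime p q) (h : Φ p * q = p * Φ q) :
    ∃ c : L, c ≠ 0 ∧ Φ p = C c * p ∧ Φ q = C c * q := by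
  obtain ⟨u, hu⟩ : q ∣ Φ q := hpq.symm.dvd_of_dvd_mul_left ⟨Φ p, by rw [← h, mul_comm]⟩
  have hdeg : u.degree = 0 := by
    have := hΦ q
    rw [hu, degree_mul] at this
    have hu0 : u ≠ 0 := by
      rintro rfl
      simp only [degree_zero, WithBot.add_bot] at this
      exact hq (degree_eq_bot.mp this.symm)
    rw [degree_eq_natDegree hq, degree_eq_natDegree hu0] at this
    rw [degree_eq_natDegree hu0]
    norm_cast at this ⊢
    omega
  obtain ⟨c, hc⟩ : ∃ c, u = C c := ⟨_, eq_C_of_degree_eq_zero hdeg⟩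
  subst hc
  refine ⟨c, fun h0 ↦ by simp [h0] at hdeg, ?_, by rw [hu, mul_comm]⟩
  apply mul_right_cancel₀ hq
  rw [h, hu]
  ring

end DegreePreserving

section Affine

open Polynomial

variable {L F ι : Type*} [Field L] [Field F] [Algebra L F]

theorem degree_eval₂_affine (τ : L →+* L) {α : L} (hα : α ≠ 0) (β : L) (p : L[X]) :
    (eval₂RingHom ((C : L →+* L[X]).comp τ) (C α * X + C β) p).degree = p.degree := by
  have hcomp : eval₂RingHom ((C : L →+* L[X]).comp τ) (C α * X + C β) p =
      (p.map τ).comp (C α * X + C β) := by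
    rw [comp, eval₂_map]; rfl
  have hlin : (C α * X + C β).natDegree = 1 := natDegree_linear hα
  have hnat : (eval₂RingHom ((C : L →+* L[X]).comp τ) (C α * X + C β) p).natDegree =
      p.natDegree := by
    rw [hcomp, natDegree_comp, hlin, mul_one, natDegree_map]
  rcases eq_or_ne p 0 with rfl | hp
  · simp
  · have hne : eval₂RingHom ((C : L →+* L[X]).comp τ) (C α * X + C β) p ≠ 0 := by
      rw [hcomp, Ne, comp_eq_zero_iff, Polynomial.map_eq_zero]
      rintro (h | ⟨-, h⟩)
      · exact hp h
      · rw [h, natDegree_C] at hlin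
        exact zero_ne_one hlin
    rw [degree_eq_natDegree hne, degree_eq_natDegree hp, hnat]

theorem aeval_eval₂_affine {x : F} {σ : F →+* F} {τ : L →+* L} {α β : L}
    (hτ : ∀ l, σ (algebraMap L F l) = algebraMap L F (τ l))
    (hσ : σ x = algebraMap L F α * x + algebraMap L F β) (p : L[X]) :
    aeval x (eval₂RingHom ((C : L →+* L[X]).comp τ) (C α * X + C β) p) = σ (aeval x p) := by
  have : ((aeval x : L[X] →ₐ[L] F) : L[X] →+* F).comp
      (eval₂RingHom ((C : L →+* L[X]).comp τ) (C α * X + C β)) =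
      σ.comp ((aeval x : L[X] →ₐ[L] F) : L[X] →+* F) := by
    ext l <;> simp [hτ, hσ]
  exact RingHom.congr_fun this p

/-- Miyata's theorem: for endomorphisms of `F` which preserve `L` and act on `x` by affine
substitutions over `L`, the invariants in `L(x)` are generated by those in `L` and at most one
further invariant, which is transcendental over `L`. -/
theorem exists_generator_of_affine {x : F} (hx : Transcendental L x)
    (σ : ι → F →+* F) (τ : ι → L →+* L) (α β : ι → L)
    (hτ : ∀ i l, σ i (algebraMap L F l) = algebraMap L F (τ i l)) (hα : ∀ i, α i ≠ 0)
    (hσ : ∀ i, σ i x = algebraMap L F (α i) * x + algebraMap L F (β i)) :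
    ∃ T : Set F, (T = ∅ ∨ ∃ f, T = {f} ∧ Transcendental L f ∧ f ∈ IntermediateField.adjoin L {x} ∧
        ∀ i, σ i f = f) ∧
      ∀ M : Subfield F, (∀ l, (∀ i, σ i (algebraMap L F l) = algebraMap L F l) →
        algebraMap L F l ∈ M) → T ⊆ M →
        ∀ y ∈ IntermediateField.adjoin L {x}, (∀ i, σ i y = y) → y ∈ M := by
  classical
  set Φ : ι → L[X] →+* L[X] := fun i ↦
    eval₂RingHom ((C : L →+* L[X]).comp (τ i)) (C (α i) * X + C (β i))
  have hΦ : ∀ i p, (Φ i p).degree = p.degree := fun i ↦ degree_eval₂_affine (τ i) (hα i) (β i)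
  have haeval : ∀ i p, aeval x (Φ i p) = σ i (aeval x p) :=
    fun i ↦ aeval_eval₂_affine (hτ i) (hσ i)
  have hinj : Function.Injective (aeval x : L[X] → F) := transcendental_iff_injective.mp hx
  have hfix : ∀ i p, Φ i p = p ↔ σ i (aeval x p) = aeval x p := fun i p ↦ by
    rw [← haeval, hinj.eq_iff]
  have hfixC : ∀ l, (∀ i, Φ i (C l) = C l) → ∀ i, σ i (algebraMap L F l) = algebraMap L F l :=
    fun l hl i ↦ by simpa using (hfix i (C l)).mp (hl i)
  have hfrac : ∀ M : Subfield F, (∀ p, (∀ i, Φ i p = p) → aeval x p ∈ M) →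
      ∀ y ∈ IntermediateField.adjoin L {x}, (∀ i, σ i y = y) → y ∈ M := by
    intro M hM y hy hyσ
    rcases eq_or_ne y 0 with rfl | hy0
    · exact M.zero_mem
    obtain ⟨r, s, hrs⟩ := (IntermediateField.mem_adjoin_simple_iff L y).mp hy
    have hs : s ≠ 0 := by rintro rfl; simp at hrs; exact hy0 hrs
    have hgcd : EuclideanDomain.gcd r s ≠ 0 := fun h ↦ hs (EuclideanDomain.gcd_eq_zero_iff.mp h).2
    obtain ⟨p, hp⟩ := EuclideanDomain.gcd_dvd_left r s
    obtain ⟨q, hq⟩ := EuclideanDomain.gcd_dvd_right r s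
    have hq0 : q ≠ 0 := by rintro rfl; rw [mul_zero] at hq; exact hs hq
    have hcop : IsCoprime p q := by
      refine ⟨EuclideanDomain.gcdA r s, EuclideanDomain.gcdB r s, mul_left_cancel₀ hgcd ?_⟩
      have := EuclideanDomain.gcd_eq_gcd_ab r s
      linear_combination -this - EuclideanDomain.gcdA r s * hp - EuclideanDomain.gcdB r s * hq
    have hxg : aeval x (EuclideanDomain.gcd r s) ≠ 0 := fun h ↦ hgcd ((transcendental_iff.mp hx) _ h)
    have hxq : aeval x q ≠ 0 := fun h ↦ hq0 ((transcendental_iff.mp hx) _ h)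
    have hy' : y = aeval x p / aeval x q := by
      have hr' := congrArg (aeval x) hp
      have hs' := congrArg (aeval x) hq
      rw [map_mul] at hr' hs'
      rw [hrs, hr', hs', mul_div_mul_left _ _ hxg]
    have hcross : ∀ i, Φ i p * q = p * Φ i q := fun i ↦ by
      apply hinj
      have h1 := hyσ i
      have hyq : y * aeval x q = aeval x p := by rw [hy', div_mul_cancel₀ _ hxq]
      have h2 := congrArg (σ i) hyq
      rw [map_mul, h1] at h2
      rw [map_mul, map_mul, haeval, haeval, ← h2, ← hyq]
      ring
    choose c hc hcp hcq using fun i ↦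
      exists_semiinvariant_of_coprime (Φ i) (hΦ i) hq0 hcop (hcross i)
    rw [hy']
    exact aeval_div_aeval_mem_of_semiinvariant Φ hΦ x M hM hx hc p q hq0 hcp hcq
  by_cases hex : ∃ p : L[X], (∀ i, Φ i p = p) ∧ 0 < p.degree
  · obtain ⟨f, ⟨hf, hf0⟩, hmin⟩ := WellFounded.has_min
      (InvImage.wf (degree : L[X] → WithBot ℕ) wellFounded_lt)
      {p : L[X] | (∀ i, Φ i p = p) ∧ 0 < p.degree} hex
    refine ⟨{aeval x f}, Or.inr ⟨_, rfl, hx.aeval f (natDegree_pos_iff_degree_pos.mpr hf0).ne'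
      (mem_nonZeroDivisors_of_ne_zero ?_), ?_, fun i ↦ (hfix i f).mp (hf i)⟩, fun M hL hT ↦ ?_⟩
    · exact leadingCoeff_ne_zero.mpr (ne_zero_of_degree_gt hf0)
    · exact (IntermediateField.mem_adjoin_simple_iff L _).mpr ⟨f, 1, by simp⟩
    · refine hfrac M fun p hp ↦ ?_
      exact aeval_mem_of_invariant_of_minimal_degree Φ hΦ x M (fun l hl ↦ hL l (hfixC l hl)) hf
        (hT rfl) hf0 (fun p hp hp0 ↦ not_lt.mp (hmin p ⟨hp, hp0⟩)) p hp
  · refine ⟨∅, Or.inl rfl, fun M hL _ ↦ hfrac M fun p hp ↦ ?_⟩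
    push Not at hex
    have hdeg := hex p hp
    rw [eq_C_of_degree_le_zero hdeg] at hp ⊢
    rw [aeval_C]
    exact hL _ (hfixC _ hp)

end Affine

section Tower

open IntermediateField IntermediateField.algebraAdjoinAdjoin

variable {k F ι : Type*} [Field k] [Field F] [Algebra k F]

/-- The inductive step: if the invariants of a stable field `L` are generated by a finite
algebraically independent set, then so are those of `L(x)`. -/
theorem exists_algebraicIndependent_generators_adjoin_simple
    (σ : ι → F →ₐ[k] F) (H : IntermediateField k F) (hH : ∀ y, y ∈ H ↔ ∀ i, σ i y = y)
    (L : IntermediateField k F) (hL : ∀ i, ∀ y ∈ L, σ i y ∈ L) {x : F} (hx : Transcendental L x)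
    (α : ι → k) (hα : ∀ i, α i ≠ 0) (hσ : ∀ i, σ i x - α i • x ∈ L)
    (hind : ∃ s : Set F, s.Finite ∧ AlgebraicIndepOn k id s ∧ adjoin k s = L ⊓ H) :
    ∃ s : Set F, s.Finite ∧ AlgebraicIndepOn k id s ∧
      adjoin k s = (adjoin L {x}).restrictScalars k ⊓ H := by
  obtain ⟨s, hsfin, hsind, hsadj⟩ := hind
  have hsub : s ⊆ (L ⊓ H : IntermediateField k F) := hsadj ▸ subset_adjoin k s
  have hLle : L ≤ (adjoin L {x}).restrictScalars k :=
    fun y hy ↦ (adjoin L {x}).algebraMap_mem ⟨y, hy⟩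
  obtain ⟨T, hT, hgen⟩ := exists_generator_of_affine hx (fun i ↦ (σ i : F →+* F))
    (fun i ↦ (σ i : F →+* F).restrict L L (hL i)) (fun i ↦ algebraMap k L (α i))
    (fun i ↦ ⟨_, hσ i⟩) (fun i l ↦ rfl) (fun i ↦ by simpa using hα i)
    (fun i ↦ by
      change σ i x = algebraMap k F (α i) * x + (σ i x - α i • x)
      rw [Algebra.smul_def]; ring)
  have hle : (adjoin L {x}).restrictScalars k ⊓ H ≤ adjoin k (T ∪ s) := by
    rintro y ⟨hy, hyH⟩
    refine hgen (adjoin k (T ∪ s)).toSubfield (fun l hl ↦ ?_)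
      (Set.subset_union_left.trans (subset_adjoin k _)) y hy ((hH y).mp hyH)
    refine adjoin.mono k s (T ∪ s) Set.subset_union_right ?_
    rw [hsadj]
    exact ⟨l.2, (hH _).mpr hl⟩
  rcases hT with rfl | ⟨f, rfl, hftr, hfmem, hfσ⟩
  · refine ⟨s, hsfin, hsind, le_antisymm ?_ (by simpa using hle)⟩
    rw [hsadj]
    exact inf_le_inf_right H hLle
  · refine ⟨{f} ∪ s, (Set.finite_singleton f).union hsfin, ?_, le_antisymm ?_ hle⟩
    · refine AlgebraicIndepOn.insert hsind ?_
      have hsL : Algebra.adjoin k (id '' s) ≤ L.toSubalgebra := by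
        rw [Set.image_id]
        exact Algebra.adjoin_le fun y hy ↦ (hsub hy).1
      exact Transcendental.of_tower_top_of_subalgebra_le hsL hftr
    · rw [adjoin_le_iff]
      rintro y (rfl | hy)
      · exact ⟨hfmem, (hH _).mpr hfσ⟩
      · exact ⟨hLle (hsub hy).1, (hsub hy).2⟩

/-- The invariants of a triangular family of linear substitutions are generated by a finite
algebraically independent set. -/
theorem exists_algebraicIndependent_generators_of_triangular {n : ℕ}
    (σ : ι → F →ₐ[k] F) (H : IntermediateField k F) (hH : ∀ y, y ∈ H ↔ ∀ i, σ i y = y)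
    {x : Fin n → F} (hx : AlgebraicIndependent k x) (htop : adjoin k (Set.range x) = ⊤)
    (c : ι → Matrix (Fin n) (Fin n) k) (htri : ∀ i, (c i).BlockTriangular id)
    (hdiag : ∀ i j, c i j j ≠ 0) (hσ : ∀ i j, σ i (x j) = ∑ l, c i j l • x l) :
    ∃ s : Set F, s.Finite ∧ AlgebraicIndepOn k id s ∧ adjoin k s = H := by
  let L : ℕ → IntermediateField k F := fun m ↦ adjoin k (x '' {j | m ≤ (j : ℕ)})
  have hmem : ∀ m (j : Fin n), m ≤ (j : ℕ) → x j ∈ L m :=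
    fun m j hj ↦ subset_adjoin k _ ⟨j, hj, rfl⟩
  have hstable : ∀ m i, ∀ y ∈ L m, σ i y ∈ L m := by
    intro m i
    change L m ≤ (L m).comap (σ i)
    rw [adjoin_le_iff]
    rintro _ ⟨j, hj, rfl⟩
    change σ i (x j) ∈ L m
    rw [hσ]
    refine sum_mem fun l _ ↦ ?_
    rcases lt_or_ge l j with hlj | hjl
    · simp [htri i (show id l < id j from hlj)]
    · exact (L m).smul_mem (hmem m l (le_trans hj hjl))
  have key : ∀ m ≤ n, ∃ s : Set F, s.Finite ∧ AlgebraicIndepOn k id s ∧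
      adjoin k s = L m ⊓ H := by
    intro m hm
    induction hm using Nat.decreasingInduction with
    | self =>
      refine ⟨∅, Set.finite_empty, ?_, ?_⟩
      · exact algebraicIndependent_empty_type_iff.mpr (algebraMap k F).injective
      · have : {j : Fin n | n ≤ (j : ℕ)} = ∅ := by
          ext j; simp
        simp [L, this]
    | of_succ m hm ih =>
      have hset : {j : Fin n | m ≤ (j : ℕ)} = insert ⟨m, hm⟩ {j : Fin n | m + 1 ≤ (j : ℕ)} := by
        ext j
        simp only [Set.mem_ofPred_eq, Set.mem_insert_iff, Fin.ext_iff]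
        omega
      have hLm : L m = (adjoin (L (m + 1)) {x ⟨m, hm⟩}).restrictScalars k := by
        rw [adjoin_adjoin_left, Set.union_singleton, ← Set.image_insert_eq, ← hset]
      rw [hLm]
      refine exists_algebraicIndependent_generators_adjoin_simple σ H hH (L (m + 1))
        (hstable _) ?_ (fun i ↦ c i ⟨m, hm⟩ ⟨m, hm⟩) (fun i ↦ hdiag i _) (fun i ↦ ?_) ih
      · have hnot : (⟨m, hm⟩ : Fin n) ∉ {j : Fin n | m + 1 ≤ (j : ℕ)} := by simp
        have htr := hx.transcendental_adjoin hnot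
        exact fun h ↦ htr ((IsFractionRing.isAlgebraic_iff (Algebra.adjoin k _) (L (m + 1)) F).mpr h)
      · rw [hσ, ← Finset.add_sum_erase _ _ (Finset.mem_univ (⟨m, hm⟩ : Fin n)), add_sub_cancel_left]
        refine sum_mem fun l hl ↦ ?_
        have hne := Finset.ne_of_mem_erase hl
        rcases lt_or_gt_of_ne hne with hlj | hjl
        · simp [htri i (show id l < id (⟨m, hm⟩ : Fin n) from hlj)]
        · exact (L (m + 1)).smul_mem (hmem _ l hjl)
  obtain ⟨s, hs⟩ := key 0 n.zero_le
  have h0 : L 0 = ⊤ := by simp [L, htop]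
  rw [h0, top_inf_eq] at hs
  exact ⟨s, hs⟩

end Tower

end TriangularInvariants

open MvPolynomial

set_option synthInstance.maxHeartbeats 1000000
set_option maxHeartbeats 1000000

/-- **Miyata–Vinberg.** Let `k` be a field of characteristic zero,
`n ≥ 1`, and let an abstract group `G` act linearly on `k^n` through a homomorphism
`ρ : G →* GLₙ(k)` whose image consists of upper-triangular matrices.  Then the field
of invariants `k(x₁,…,xₙ)^G` of the induced action `a` on the rational function field
is purely transcendental over `k`. -/
theorem invariant_field_of_triangular_action_is_pure
    (k : Type) [Field k] [CharZero k]
    (G : Type) [Group G]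
    (n : ℕ) (hn : 1 ≤ n)
    (ρ : G →* Matrix.GeneralLinearGroup (Fin n) k)
    (htri : ∀ g : G, ((ρ g : Matrix (Fin n) (Fin n) k)).BlockTriangular id)
    (a : G →* (FractionRing (MvPolynomial (Fin n) k) ≃ₐ[k]
      FractionRing (MvPolynomial (Fin n) k)))
    (ha : ∀ (g : G) (i : Fin n),
      a g (algebraMap (MvPolynomial (Fin n) k) (FractionRing (MvPolynomial (Fin n) k)) (X i)) =
        algebraMap (MvPolynomial (Fin n) k) (FractionRing (MvPolynomial (Fin n) k))
          (∑ j, ((ρ g⁻¹ : Matrix (Fin n) (Fin n) k) i j) • X j)) :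
    ∃ t : ℕ, Nonempty
      ((IntermediateField.fixedField a.range) ≃ₐ[k]
        FractionRing (MvPolynomial (Fin t) k)) := by
  set F := FractionRing (MvPolynomial (Fin n) k)
  let x : Fin n → F := fun i ↦ algebraMap (MvPolynomial (Fin n) k) F (X i)
  have hx : AlgebraicIndependent k x :=
    (MvPolynomial.algebraicIndependent_X (Fin n) k).map' (f := IsScalarTower.toAlgHom k _ F)
      (IsFractionRing.injective (MvPolynomial (Fin n) k) F)
  have htop : IntermediateField.adjoin k (Set.range x) = ⊤ := by
    have hpoly : ∀ p, algebraMap (MvPolynomial (Fin n) k) F p ∈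
        IntermediateField.adjoin k (Set.range x) := fun p ↦ by
      induction p using MvPolynomial.induction_on with
      | C c => exact (IntermediateField.adjoin k (Set.range x)).algebraMap_mem c
      | add p q hp hq => rw [map_add]; exact add_mem hp hq
      | mul_X p i hp =>
        rw [map_mul]
        exact mul_mem hp (IntermediateField.subset_adjoin k _ ⟨i, rfl⟩)
    refine eq_top_iff.mpr fun y _ ↦ ?_
    obtain ⟨p, q, -, rfl⟩ := IsFractionRing.div_surjective (A := MvPolynomial (Fin n) k) y
    exact div_mem (hpoly p) (hpoly q)
  have hdiag : ∀ (g : G) (j : Fin n), (ρ g⁻¹ : Matrix (Fin n) (Fin n) k) j j ≠ 0 := fun g j h ↦ by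
    have hdet : IsUnit (ρ g⁻¹ : Matrix (Fin n) (Fin n) k).det :=
      (Matrix.isUnit_iff_isUnit_det _).mp (ρ g⁻¹).isUnit
    rw [Matrix.det_of_isUpperTriangular (htri g⁻¹)] at hdet
    exact hdet.ne_zero (Finset.prod_eq_zero (Finset.mem_univ j) h)
  obtain ⟨s, hsfin, hsind, hsadj⟩ :=
    TriangularInvariants.exists_algebraicIndependent_generators_of_triangular
      (fun g ↦ (a g : F →ₐ[k] F)) (IntermediateField.fixedField a.range)
      (fun y ↦ by
        rw [IntermediateField.mem_fixedField_iff]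
        simp) hx htop (fun g ↦ (ρ g⁻¹ : Matrix (Fin n) (Fin n) k)) (fun g ↦ htri g⁻¹) hdiag
      (fun g j ↦ by
        refine (ha g j).trans ?_
        rw [map_sum]
        refine Finset.sum_congr rfl fun l _ ↦ ?_
        exact map_smul (IsScalarTower.toAlgHom k (MvPolynomial (Fin n) k) F) _ _)
  have : Finite s := hsfin
  obtain ⟨t, ⟨e⟩⟩ := Finite.exists_equiv_fin s
  have hind : AlgebraicIndependent k (fun i ↦ (e.symm i : F)) := hsind.comp _ e.symm.injective
  have hrange : Set.range (fun i ↦ (e.symm i : F)) = s := by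
    rw [show (fun i ↦ (e.symm i : F)) = Subtype.val ∘ e.symm from rfl, e.symm.surjective.range_comp,
      Subtype.range_val]
  have heq : IntermediateField.fixedField a.range =
      IntermediateField.adjoin k (Set.range fun i ↦ (e.symm i : F)) := by rw [hrange, hsadj]
  exact ⟨t, ⟨(IntermediateField.equivOfEq heq).trans hind.aevalEquivField.symm⟩⟩
end

section
/- (Fischer's theorem, general form.) Let k be an algebraically closed field of characteristic zero, V a finite-dimensional k-vector space, and G a commutative subgroup of GL(V) all of whose elements are semisimple (diagonalizable) linear automorphisms of V. Then the field of invariants k(V)^G is purely transcendental over k. -/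
open MvPolynomial

set_option synthInstance.maxHeartbeats 1000000
set_option maxHeartbeats 1000000

open Module in
theorem isSemisimple_of_basis_eigenvectors {k V ι : Type*} [Field k] [AddCommGroup V] [Module k V]
    [Finite ι] (b : Basis ι k V) (f : End k V) (d : ι → k) (h : ∀ i, f (b i) = d i • b i) :
    f.IsSemisimple := by
  classical
  cases nonempty_fintype ι
  let s := Finset.univ.image d
  refine End.isSemisimple_of_squarefree_aeval_eq_zero
    (p := ∏ μ ∈ s, (Polynomial.X - Polynomial.C μ))
    (Polynomial.separable_prod_X_sub_C_iff'.2 (fun _ _ _ _ h => h)).squarefree ?_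
  refine b.ext fun i => ?_
  have hi : d i ∈ s := Finset.mem_image_of_mem d (Finset.mem_univ i)
  rw [← Finset.prod_erase_mul _ _ hi]
  simp [h]

open Module in
theorem exists_basis_simultaneous_eigenvectors {k V ι : Type*} [Field k] [IsAlgClosed k]
    [AddCommGroup V] [Module k V] [FiniteDimensional k V] (f : ι → End k V)
    (hc : ∀ i j, Commute (f i) (f j)) (hs : ∀ i, (f i).IsSemisimple) :
    ∃ b : Basis (Fin (finrank k V)) k V, ∀ i j, ∃ c : k, f i (b j) = c • b j := by
  let s : Set V := {v | ∀ i, ∃ c : k, f i v = c • v}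
  have hspan : ⊤ ≤ Submodule.span k s := by
    rw [← End.iSup_iInf_maxGenEigenspace_eq_top_of_iSup_maxGenEigenspace_eq_top_of_commute f
      (fun i j _ => hc i j) (fun i => End.iSup_maxGenEigenspace_eq_top (f i))]
    refine iSup_le fun χ v hv => Submodule.subset_span fun i => ⟨χ i, ?_⟩
    rw [Submodule.mem_iInf] at hv
    have := hv i
    rwa [(hs i).isFinitelySemisimple.maxGenEigenspace_eq_eigenspace, End.mem_eigenspace_iff] at this
  let B := Basis.ofSpan hspan
  have := FiniteDimensional.fintypeBasisIndex B
  refine ⟨B.reindex (Fintype.equivOfCardEq (by simp [finrank_eq_card_basis B])), fun i j => ?_⟩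
  rw [Basis.reindex_apply]
  exact Basis.ofSpan_subset hspan ⟨_, rfl⟩ i

theorem isSemisimple_vecMulLinear {k : Type*} [Field k] {n : ℕ} (M P Q : Matrix (Fin n) (Fin n) k)
    (hPQ : P * Q = 1) (d : Fin n → k) (hM : M = P * Matrix.diagonal d * Q) :
    Module.End.IsSemisimple (M.vecMulLinear : Module.End k (Fin n → k)) := by
  have hQP : Q * P = 1 := mul_eq_one_comm.1 hPQ
  let e : (Fin n → k) ≃ₗ[k] (Fin n → k) := LinearEquiv.ofLinearMap P.vecMulLinear Q.vecMulLinear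
    (LinearMap.ext fun v => by simp [Matrix.vecMul_vecMul, hQP])
    (LinearMap.ext fun v => by simp [Matrix.vecMul_vecMul, hPQ])
  refine isSemisimple_of_basis_eigenvectors (Module.Basis.ofEquivFun e) _ d fun i => ?_
  have : e.symm (Pi.single i 1) = Matrix.vecMul (Pi.single i 1) Q := rfl
  simp only [Module.Basis.coe_ofEquivFun, this, Matrix.vecMulLinear_apply, Matrix.vecMul_vecMul, hM,
    ← Matrix.mul_assoc, hQP, one_mul]
  rw [← Matrix.vecMul_vecMul, ← Matrix.smul_vecMul]
  congr 1
  ext j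
  simp [Pi.single_apply, eq_comm]

/-- The Laurent monomial `∏ i, y i ^ m i`. -/
noncomputable def laurentMonomial {ι E : Type*} [Fintype ι] [Field E] (y : ι → E) (m : ι → ℤ) : E :=
  ∏ i, y i ^ m i

section laurentMonomial

variable {ι E : Type*} [Fintype ι] [Field E] {y : ι → E}

theorem laurentMonomial_ne_zero (hy : ∀ i, y i ≠ 0) (m : ι → ℤ) : laurentMonomial y m ≠ 0 :=
  Finset.prod_ne_zero_iff.2 fun i _ => zpow_ne_zero _ (hy i)

theorem laurentMonomial_zero : laurentMonomial y 0 = 1 := by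
  simp [laurentMonomial]

theorem laurentMonomial_add (hy : ∀ i, y i ≠ 0) (m l : ι → ℤ) :
    laurentMonomial y (m + l) = laurentMonomial y m * laurentMonomial y l := by
  simp [laurentMonomial, zpow_add₀ (hy _), Finset.prod_mul_distrib]

theorem laurentMonomial_neg (m : ι → ℤ) :
    laurentMonomial y (-m) = (laurentMonomial y m)⁻¹ := by
  simp [laurentMonomial]

theorem laurentMonomial_sub (hy : ∀ i, y i ≠ 0) (m l : ι → ℤ) :
    laurentMonomial y (m - l) = laurentMonomial y m / laurentMonomial y l := by
  rw [sub_eq_add_neg, laurentMonomial_add hy, laurentMonomial_neg, div_eq_mul_inv]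

theorem laurentMonomial_sum_zsmul (hy : ∀ i, y i ≠ 0) {κ : Type*} (s : Finset κ) (c : κ → ℤ)
    (b : κ → ι → ℤ) :
    laurentMonomial y (∑ j ∈ s, c j • b j) = ∏ j ∈ s, laurentMonomial y (b j) ^ c j := by
  simp only [laurentMonomial, Finset.sum_apply, Pi.smul_apply, smul_eq_mul, ← Finset.prod_zpow]
  rw [Finset.prod_comm]
  refine Finset.prod_congr rfl fun i _ => ?_
  induction s using Finset.cons_induction with
  | empty => simp
  | cons j s hj ih => simp [zpow_add₀ (hy i), ih, ← zpow_mul, mul_comm (c j)]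

variable {k : Type*} [Field k] [Algebra k E]

theorem aeval_eq_sum_laurentMonomial (p : MvPolynomial ι k) :
    aeval y p = ∑ u ∈ p.support, p.coeff u • laurentMonomial y (fun i => (u i : ℤ)) := by
  simp [aeval_def, eval₂_eq', laurentMonomial, Algebra.smul_def]

theorem linearIndependent_laurentMonomial (hy : AlgebraicIndependent k y) :
    LinearIndependent k (laurentMonomial y) := by
  have hy0 : ∀ i, y i ≠ 0 := hy.ne_zero
  classical
  rw [linearIndependent_iff']
  intro s c hc m hm
  let N : ι → ℤ := fun i => ∑ l ∈ s, |l i|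
  have hN : ∀ l ∈ s, ∀ i, 0 ≤ l i + N i := fun l hl i => by
    have h1 : |l i| ≤ N i := Finset.single_le_sum (f := fun l : ι → ℤ => |l i|)
      (fun _ _ => abs_nonneg _) hl
    have h2 := neg_abs_le (l i)
    omega
  let e : (ι → ℤ) → ι →₀ ℕ := fun l => Finsupp.equivFunOnFinite.symm fun i => (l i + N i).toNat
  have he : ∀ l ∈ s, (fun i => (e l i : ℤ)) = l + N := fun l hl => by
    ext i
    simp [e, hN l hl i]
  have hp : aeval y (∑ l ∈ s, monomial (e l) (c l)) = 0 := by
    rw [map_sum, ← zero_mul (laurentMonomial y N), ← hc, Finset.sum_mul]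
    refine Finset.sum_congr rfl fun l hl => ?_
    rw [smul_mul_assoc, ← laurentMonomial_add hy0, ← he l hl, aeval_monomial, Algebra.smul_def]
    simp [laurentMonomial, Finsupp.prod_fintype]
  have h0 := congrArg (coeff (e m)) (algebraicIndependent_iff.1 hy _ hp)
  rw [coeff_sum, Finset.sum_eq_single_of_mem m hm] at h0
  · simpa [coeff_monomial] using h0
  · intro l hl hlm
    rw [coeff_monomial, if_neg]
    intro h
    apply hlm
    have := (he l hl).symm.trans ((congrArg (fun v : ι →₀ ℕ => fun i => (v i : ℤ)) h).trans (he m hm))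
    exact add_right_cancel this

theorem algebraicIndependent_laurentMonomial (hy : AlgebraicIndependent k y) {κ : Type*} [Fintype κ]
    {b : κ → ι → ℤ} (hb : LinearIndependent ℤ b) :
    AlgebraicIndependent k fun j => laurentMonomial y (b j) := by
  have hy0 : ∀ i, y i ≠ 0 := hy.ne_zero
  rw [algebraicIndependent_iff]
  intro p hp
  have hinj : Function.Injective fun u : κ →₀ ℕ => ∑ j, (u j : ℤ) • b j := fun u v huv => by
    ext j
    have h : Fintype.linearCombination ℤ b (fun j => (u j : ℤ)) =
        Fintype.linearCombination ℤ b (fun j => (v j : ℤ)) := by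
      simpa only [Fintype.linearCombination_apply] using huv
    exact_mod_cast congrFun (hb.fintypeLinearCombination_injective h) j
  have hli := (linearIndependent_laurentMonomial hy).comp _ hinj
  rw [aeval_eq_sum_laurentMonomial] at hp
  ext u
  rw [coeff_zero]
  by_contra hu
  refine hu (linearIndependent_iff'.1 hli p.support (fun u => p.coeff u) ?_ u (by simpa using hu))
  rw [← hp]
  refine Finset.sum_congr rfl fun v _ => ?_
  simp only [Function.comp_apply, laurentMonomial_sum_zsmul hy0]
  rfl

end laurentMonomial

/-- If a group acts on a purely transcendental extension by scaling each member of a generating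
algebraically independent family, then its fixed field is generated by algebraically independent
Laurent monomials. -/
theorem fixedField_pure_of_scaling {k E G ι : Type*} [Field k] [Field E] [Algebra k E] [Group G]
    [Finite ι] (a : G →* (E ≃ₐ[k] E)) (y : ι → E) (hy : AlgebraicIndependent k y)
    (hgen : IntermediateField.adjoin k (Set.range y) = ⊤)
    (hscale : ∀ g i, ∃ c : k, a g (y i) = c • y i) :
    ∃ t : ℕ, Nonempty ((IntermediateField.fixedField a.range) ≃ₐ[k]
      FractionRing (MvPolynomial (Fin t) k)) := by
  classical
  cases nonempty_fintype ι
  have hy0 : ∀ i, y i ≠ 0 := hy.ne_zero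
  choose χ hχ using hscale
  let M := laurentMonomial y
  have hM0 : ∀ m, M m ≠ 0 := laurentMonomial_ne_zero hy0
  have hM : ∀ g m, ∃ c : k, a g (M m) = algebraMap k E c * M m := fun g m =>
    ⟨∏ i, χ g i ^ m i, by
      simp [M, laurentMonomial, hχ, Algebra.smul_def, mul_zpow, Finset.prod_mul_distrib]⟩
  let W : (ι → ℤ) → G →* E := fun m =>
    { toFun := fun g => a g (M m) / M m
      map_one' := by simp [hM0]
      map_mul' := fun g h => by
        obtain ⟨c, hc⟩ := hM h m
        have := hM0 m
        simp only [map_mul, AlgEquiv.mul_apply, hc, AlgEquiv.commutes]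
        field_simp }
  have hW : ∀ m g, a g (M m) = W m g * M m := fun m g => (div_mul_cancel₀ _ (hM0 m)).symm
  let L : AddSubgroup (ι → ℤ) :=
    { carrier := {m | ∀ g, a g (M m) = M m}
      zero_mem' := fun g => by simp [M, laurentMonomial_zero]
      add_mem' := fun {m l} hm hl g => by
        simp only [M, laurentMonomial_add hy0, map_mul] at *
        rw [hm, hl]
      neg_mem' := fun {m} hm g => by
        simp only [M, laurentMonomial_neg, map_inv₀] at *
        rw [hm] }
  obtain ⟨t, b⟩ := Submodule.basisOfPid (Pi.basisFun ℤ ι) (AddSubgroup.toIntSubmodule L)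
  let z : Fin t → E := fun j => M (b j)
  have hz : AlgebraicIndependent k z := algebraicIndependent_laurentMonomial hy
    (b := fun j => (b j : ι → ℤ))
    (b.linearIndependent.map' (Submodule.subtype _) (Submodule.ker_subtype _))
  let K := IntermediateField.adjoin k (Set.range z)
  have hLK : ∀ m ∈ L, M m ∈ K := fun m hm => by
    have h := congrArg Subtype.val (b.sum_repr ⟨m, hm⟩)
    simp only [AddSubmonoidClass.coe_finsetSum, SetLike.val_smul] at h
    rw [← h]
    simp only [M, laurentMonomial_sum_zsmul hy0]
    exact prod_mem fun j _ => zpow_mem (IntermediateField.subset_adjoin k _ (Set.mem_range_self j)) _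
  let φ : (ι →₀ ℕ) → ι → ℤ := fun u i => u i
  have hsub : ∀ (T : Finset (ι →₀ ℕ)) (c : (ι →₀ ℕ) → k) (u₀ : ι →₀ ℕ),
      (∑ u ∈ T with W (φ u) = W (φ u₀), algebraMap k E (c u) * M (φ u)) / M (φ u₀) ∈ K := by
    intro T c u₀
    rw [Finset.sum_div]
    refine sum_mem fun u hu => ?_
    rw [mul_div_assoc]
    refine mul_mem (K.algebraMap_mem _) ?_
    have : M (φ u) / M (φ u₀) = M (φ u - φ u₀) := (laurentMonomial_sub hy0 _ _).symm
    rw [this]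
    refine hLK _ fun g => ?_
    rw [← this, map_div₀, hW, hW, (Finset.mem_filter.1 hu).2]
    refine mul_div_mul_left _ _ fun h => ?_
    have := hW (φ u₀) g
    rw [h, zero_mul, map_eq_zero] at this
    exact hM0 _ this
  have hfix : IntermediateField.fixedField a.range = K := by
    apply le_antisymm
    · intro f hf
      rw [IntermediateField.mem_fixedField_iff] at hf
      have hf' : ∀ g, a g f = f := fun g => hf _ ⟨g, rfl⟩
      obtain ⟨r, s, hrs⟩ := (IntermediateField.mem_adjoin_range_iff k y f).1
        (hgen ▸ IntermediateField.mem_top)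
      by_cases hs : aeval y s = 0
      · rw [hrs, hs, div_zero]
        exact zero_mem _
      let T := r.support ∪ s.support
      have hexp : ∀ p : MvPolynomial ι k, p.support ⊆ T →
          aeval y p = ∑ u ∈ T, algebraMap k E (p.coeff u) * M (φ u) := fun p hp => by
        rw [aeval_eq_sum_laurentMonomial, Finset.sum_subset hp]
        · exact Finset.sum_congr rfl fun u _ => Algebra.smul_def _ _
        · intro u _ hu
          rw [notMem_support_iff.1 hu, zero_smul]
      have hr := hexp r Finset.subset_union_left
      have hs' := hexp s Finset.subset_union_right
      let part : MvPolynomial ι k → (G →* E) → E := fun p ω =>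
        ∑ u ∈ T with W (φ u) = ω, algebraMap k E (p.coeff u) * M (φ u)
      have hrel : ∑ u ∈ T, (f * algebraMap k E (s.coeff u) - algebraMap k E (r.coeff u)) * M (φ u)
          = 0 := by
        simp only [sub_mul, Finset.sum_sub_distrib, mul_assoc, ← Finset.mul_sum]
        rw [← hr, ← hs', hrs, div_mul_cancel₀ _ hs, sub_self]
      have hpart : ∀ ω ∈ T.image (W ∘ φ), f * part s ω - part r ω = 0 := by
        refine linearIndependent_iff'.1 (linearIndependent_monoidHom G E) (T.image (W ∘ φ))
          (fun ω => f * part s ω - part r ω) (funext fun g => ?_)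
        change _ = (0 : E)
        have hg := congrArg (a g) hrel
        simp only [map_sum, map_mul, map_sub, AlgEquiv.commutes, hf', hW, map_zero] at hg
        rw [← hg, ← Finset.sum_fiberwise_of_maps_to (t := T.image (W ∘ φ)) (g := W ∘ φ)
          (fun u hu => Finset.mem_image_of_mem _ hu), Finset.sum_apply]
        refine Finset.sum_congr rfl fun ω _ => ?_
        simp only [part, Pi.smul_apply, smul_eq_mul, Finset.mul_sum, ← Finset.sum_sub_distrib,
          Finset.sum_mul, Function.comp_apply]
        refine Finset.sum_congr rfl fun u hu => ?_
        rw [(Finset.mem_filter.1 hu).2]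
        ring
      obtain ⟨ω, hω, hne⟩ : ∃ ω ∈ T.image (W ∘ φ), part s ω ≠ 0 := by
        refine Finset.exists_ne_zero_of_sum_ne_zero ?_
        rw [hs', ← Finset.sum_fiberwise_of_maps_to (t := T.image (W ∘ φ)) (g := W ∘ φ)
          (fun u hu => Finset.mem_image_of_mem _ hu)] at hs
        exact hs
      have hω' := hpart ω hω
      obtain ⟨u₀, -, rfl⟩ := Finset.mem_image.1 hω
      have hfq : f = (part r (W (φ u₀)) / M (φ u₀)) / (part s (W (φ u₀)) / M (φ u₀)) := by
        rw [div_div_div_cancel_right₀ (hM0 _), eq_div_iff (by exact hne)]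
        exact sub_eq_zero.1 hω'
      rw [hfq]
      exact div_mem (hsub T _ u₀) (hsub T _ u₀)
    · rw [IntermediateField.adjoin_le_iff]
      rintro _ ⟨j, rfl⟩
      rw [SetLike.mem_coe, IntermediateField.mem_fixedField_iff]
      rintro _ ⟨g, rfl⟩
      exact (b j).2 g
  exact ⟨t, ⟨(IntermediateField.equivOfEq hfix).trans hz.aevalEquivField.symm⟩⟩

/-- **Fischer's theorem, general form.** Let `k` be an algebraically closed
field of characteristic zero, `V = k^n`, and let `H` be a commutative subgroup of
`GL(V) = GLₙ(k)` all of whose elements are diagonalizable.  Then the field of invariants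
`k(V)^H` (the fixed field of the induced action `a` of `H` on the rational function
field) is purely transcendental over `k`. -/
theorem invariant_field_of_commutative_semisimple_group_is_pure
    (k : Type) [Field k] [IsAlgClosed k] [CharZero k]
    (n : ℕ)
    (H : Subgroup (Matrix.GeneralLinearGroup (Fin n) k))
    (hcomm : ∀ x ∈ H, ∀ y ∈ H, x * y = y * x)
    (hss : ∀ g ∈ H, ∃ (P : Matrix.GeneralLinearGroup (Fin n) k) (d : Fin n → k),
      (g : Matrix (Fin n) (Fin n) k) =
        (P : Matrix (Fin n) (Fin n) k) * Matrix.diagonal d * ((P⁻¹ : Matrix.GeneralLinearGroup (Fin n) k) : Matrix (Fin n) (Fin n) k))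
    (a : H →* (FractionRing (MvPolynomial (Fin n) k) ≃ₐ[k]
      FractionRing (MvPolynomial (Fin n) k)))
    (ha : ∀ (g : H) (i : Fin n),
      a g (algebraMap (MvPolynomial (Fin n) k) (FractionRing (MvPolynomial (Fin n) k)) (X i)) =
        algebraMap (MvPolynomial (Fin n) k) (FractionRing (MvPolynomial (Fin n) k))
          (∑ j, (((g⁻¹ : Matrix.GeneralLinearGroup (Fin n) k) :
            Matrix (Fin n) (Fin n) k) i j) • X j)) :
    ∃ t : ℕ, Nonempty
      ((IntermediateField.fixedField a.range) ≃ₐ[k]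
        FractionRing (MvPolynomial (Fin t) k)) := by
  let F := FractionRing (MvPolynomial (Fin n) k)
  let f : H → Module.End k (Fin n → k) := fun g =>
    ((g⁻¹ : Matrix.GeneralLinearGroup (Fin n) k) : Matrix (Fin n) (Fin n) k).vecMulLinear
  have hf : ∀ g, f g =
    ((g⁻¹ : Matrix.GeneralLinearGroup (Fin n) k) : Matrix (Fin n) (Fin n) k).vecMulLinear :=
    fun _ => rfl
  have hc : ∀ g h, Commute (f g) (f h) := fun g h => by
    refine LinearMap.ext fun v => ?_
    have := congrArg (fun x : Matrix.GeneralLinearGroup (Fin n) k =>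
      (x : Matrix (Fin n) (Fin n) k)) (hcomm _ (inv_mem g.2) _ (inv_mem h.2))
    simp only [Units.val_mul] at this
    simp only [Module.End.mul_apply, hf, Matrix.vecMulLinear_apply, Matrix.vecMul_vecMul, this]
  have hs : ∀ g, (f g).IsSemisimple := fun g => by
    obtain ⟨P, d, hP⟩ := hss _ (inv_mem g.2)
    exact isSemisimple_vecMulLinear _ _ _ (by simp) d hP
  obtain ⟨b, hb⟩ := exists_basis_simultaneous_eigenvectors f hc hs
  let b₀ := Pi.basisFun k (Fin n)
  let e := (SymmetricAlgebra.equivMvPolynomial b).symm.trans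
    (SymmetricAlgebra.equivMvPolynomial b₀)
  let lin : (Fin n → k) →ₗ[k] F := (Algebra.linearMap (MvPolynomial (Fin n) k) F).restrictScalars k
    ∘ₗ (SymmetricAlgebra.equivMvPolynomial b₀).toLinearMap ∘ₗ SymmetricAlgebra.ι k _
  have hlin₀ : ∀ i, lin (b₀ i) = algebraMap (MvPolynomial (Fin n) k) F (X i) := fun i => by
    simp [lin]
  have hlin : ∀ j, lin (b j) = algebraMap (MvPolynomial (Fin n) k) F (e (X j)) := fun j => by
    simp [lin, e]
  have hequiv : ∀ g v, a g (lin v) = lin (f g v) := fun g v => by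
    suffices h : (a g).toLinearMap ∘ₗ lin = lin ∘ₗ f g from LinearMap.congr_fun h v
    refine b₀.ext fun i => ?_
    have hrow : f g (b₀ i) = ∑ j, (((g⁻¹ : Matrix.GeneralLinearGroup (Fin n) k) :
        Matrix (Fin n) (Fin n) k) i j) • b₀ j := by
      ext l
      simp [hf, b₀, Pi.single_apply]
    simp only [LinearMap.comp_apply, AlgEquiv.toLinearMap_apply, hrow, map_sum, map_smul, hlin₀]
    refine (ha g i).trans ((map_sum _ _ _).trans (Finset.sum_congr rfl fun j _ => ?_))
    exact map_smul (IsScalarTower.toAlgHom k (MvPolynomial (Fin n) k) F) _ _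
  let ψ : MvPolynomial (Fin (Module.finrank k (Fin n → k))) k →ₐ[k] F :=
    (IsScalarTower.toAlgHom k (MvPolynomial (Fin n) k) F).comp e.toAlgHom
  have hψ : ψ = aeval (fun j => lin (b j)) := by
    ext j
    simp [ψ, hlin]
  refine fixedField_pure_of_scaling a (fun j => lin (b j)) ?_ ?_ fun g j => ?_
  · rw [algebraicIndependent_iff_injective_aeval, ← hψ]
    exact (IsFractionRing.injective (MvPolynomial (Fin n) k) F).comp e.injective
  · refine eq_top_iff.2 fun x _ => ?_
    obtain ⟨p, q, -, rfl⟩ := IsFractionRing.div_surjective (A := MvPolynomial (Fin n) k) x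
    rw [IntermediateField.mem_adjoin_range_iff]
    refine ⟨e.symm p, e.symm q, ?_⟩
    rw [← hψ]
    simp [ψ]
    rfl
  · obtain ⟨c, hc⟩ := hb g j
    exact ⟨c, by rw [hequiv, hc, map_smul]⟩
end

section
/- Let k be a field of characteristic zero and n ≥ 1. For any faithful finite-dimensional linear representation V of the symmetric group S_n over k, the field of invariants k(V)^{S_n} is stably pure over k. -/
open MvPolynomial

section NoName

variable {k K L G ι : Type*} [Field k] [Field K] [Field L] [Algebra k L] [Algebra K L]
  [Group G] [Finite G]

/-- An invariant quotient of elements of a stable subring is a quotient of invariant elements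
of that subring. -/
theorem exists_invariant_div (b : G →* (L ≃ₐ[k] L)) (R : Subring L)
    (hR : ∀ g, ∀ r ∈ R, b g r ∈ R) {z : L} (hz : ∀ g, b g z = z)
    (hq : ∃ p ∈ R, ∃ q ∈ R, z = p / q) :
    ∃ p ∈ R, ∃ q ∈ R, (∀ g, b g p = p) ∧ (∀ g, b g q = q) ∧ z = p / q := by
  classical
  have := Fintype.ofFinite G
  obtain ⟨p, hp, q, hq, rfl⟩ := hq
  by_cases hq0 : q = 0
  · exact ⟨0, R.zero_mem, 1, R.one_mem, by simp, by simp, by simp [hq0]⟩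
  have hnorm : ∀ g, b g (∏ h, b h q) = ∏ h, b h q := fun g ↦ by
    rw [map_prod]
    exact Fintype.prod_equiv (Equiv.mulLeft g) _ _ fun h ↦ by simp
  have hne : ∏ h, b h q ≠ 0 := by
    simpa [Finset.prod_eq_zero_iff] using hq0
  refine ⟨p / q * ∏ h, b h q, ?_, ∏ h, b h q, R.prod_mem fun h _ ↦ hR h q hq,
    fun g ↦ by rw [map_mul, hz, hnorm], hnorm, by field_simp⟩
  rw [← Finset.mul_prod_erase Finset.univ (fun h ↦ b h q) (Finset.mem_univ 1), ← mul_assoc]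
  refine R.mul_mem ?_ (R.prod_mem fun h _ ↦ hR h q hq)
  simpa [hq0] using hp

/-- Galois descent: a stable `K`-subspace of `L` is spanned by invariants if `G` acts
faithfully on `K`. -/
theorem le_span_invariants (b : G →* (L ≃ₐ[k] L))
    (hK : ∀ g, ∀ c : K, ∃ c' : K, b g (algebraMap K L c) = algebraMap K L c')
    (hfaith : ∀ g, (∀ c : K, b g (algebraMap K L c) = algebraMap K L c) → g = 1)
    (W : Submodule K L) (hW : ∀ g, ∀ w ∈ W, b g w ∈ W) :
    W ≤ Submodule.span K {w | w ∈ W ∧ ∀ g, b g w = w} := by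
  classical
  have := Fintype.ofFinite G
  intro w hw
  by_contra hnot
  obtain ⟨f, hfw, hf⟩ := Submodule.exists_le_ker_of_notMem hnot
  choose σ hσ using hK
  let χ : G → (K →* L) := fun g ↦ ((b g : L →+* L).comp (algebraMap K L) : K →+* L)
  have hχ : Function.Injective χ := fun g h hgh ↦ by
    have h1 : h⁻¹ * g = 1 := hfaith _ fun c ↦ by
      have := DFunLike.congr_fun hgh c
      simp only [χ, MonoidHom.coe_coe, RingHom.comp_apply, RingHom.coe_coe] at this
      rw [map_mul, AlgEquiv.mul_apply, this, ← AlgEquiv.mul_apply, ← map_mul]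
      simp
    exact (inv_mul_eq_one.mp h1).symm
  have hli := (linearIndependent_monoidHom K L).comp χ hχ
  rw [Fintype.linearIndependent_iff] at hli
  refine hfw ?_
  have key : ∑ g, algebraMap K L (f (b g w)) • ((χ g : K →* L) : K → L) = 0 := by
    ext c
    have hmem : ∑ g, b g (c • w) ∈ {w | w ∈ W ∧ ∀ g, b g w = w} :=
      ⟨W.sum_mem fun g _ ↦ hW g _ (W.smul_mem c hw), fun g ↦ by
        rw [map_sum]
        exact Fintype.sum_equiv (Equiv.mulLeft g) _ _ fun h ↦ by simp⟩
    have h0 := hf (Submodule.subset_span hmem)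
    have hterm : ∀ g, b g (c • w) = σ g c • b g w := fun g ↦ by
      rw [Algebra.smul_def, map_mul, hσ, Algebra.smul_def]
    simp only [hterm, LinearMap.mem_ker, map_sum, map_smul, smul_eq_mul] at h0
    have h1 := congrArg (algebraMap K L) h0
    simp only [map_sum, map_mul, map_zero] at h1
    simp only [Finset.sum_apply, Pi.smul_apply, smul_eq_mul, Pi.zero_apply]
    rw [← h1]
    refine Finset.sum_congr rfl fun g _ ↦ ?_
    rw [← hσ, mul_comm]
    rfl
  have := hli _ key 1
  simpa using this

/-- Elements of a field generated by `s` are algebraic over the algebra generated by `s`. -/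
theorem isAlgebraic_adjoin_of_adjoin_eq_top {s : Set L}
    (h : IntermediateField.adjoin K s = ⊤) : Algebra.IsAlgebraic (Algebra.adjoin K s) L := by
  refine ⟨fun z ↦ ?_⟩
  obtain ⟨p, hp, q, hq, rfl⟩ :=
    IntermediateField.mem_adjoin_iff_div.mp (h ▸ IntermediateField.mem_top : z ∈ _)
  rw [div_eq_mul_inv]
  exact (isAlgebraic_algebraMap (⟨p, hp⟩ : Algebra.adjoin K s)).mul
    (isAlgebraic_algebraMap (⟨q, hq⟩ : Algebra.adjoin K s)).inv

/-- The no-name lemma: if `L` is generated over `K` by algebraically independent elements spanning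
a stable subspace and `G` acts faithfully on `K`, then these can be replaced by invariant
elements, and the invariant field is generated by them and the invariants of `K`. -/
theorem exists_algebraicIndependent_invariants [Fintype ι] (b : G →* (L ≃ₐ[k] L))
    (hK : ∀ g, ∀ c : K, ∃ c' : K, b g (algebraMap K L c) = algebraMap K L c')
    (hfaith : ∀ g, (∀ c : K, b g (algebraMap K L c) = algebraMap K L c) → g = 1)
    (x : ι → L) (hx : AlgebraicIndependent K x)
    (hgen : IntermediateField.adjoin K (Set.range x) = ⊤)
    (hspan : ∀ g i, b g (x i) ∈ Submodule.span K (Set.range x)) :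
    ∃ y : ι → L, AlgebraicIndependent K y ∧ (∀ g i, b g (y i) = y i) ∧
      ∀ S : Subfield L, (∀ i, y i ∈ S) →
        (∀ c : K, (∀ g, b g (algebraMap K L c) = algebraMap K L c) → algebraMap K L c ∈ S) →
        ∀ z, (∀ g, b g z = z) → z ∈ S := by
  have hK' := hK
  choose σ hσ using hK'
  have hsemi : ∀ g c w, b g (c • w) = σ g c • b g w := fun g c w ↦ by
    rw [Algebra.smul_def, map_mul, hσ, Algebra.smul_def]
  set W := Submodule.span K (Set.range x) with hWdef
  have hW : ∀ g, ∀ w ∈ W, b g w ∈ W := fun g w hw ↦ by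
    induction hw using Submodule.span_induction with
    | mem w hw => obtain ⟨i, rfl⟩ := hw; exact hspan g i
    | zero => simp
    | add u v _ _ hu hv => rw [map_add]; exact W.add_mem hu hv
    | smul c u _ hu => rw [hsemi]; exact W.smul_mem _ hu
  have hle := le_span_invariants b hK hfaith W hW
  set s := {w | w ∈ W ∧ ∀ g, b g w = w} with hs
  have hsW : Submodule.span K s = W :=
    le_antisymm (Submodule.span_le.mpr fun w hw ↦ hw.1) hle
  have : Module.Finite K (Submodule.span K s) := by
    rw [hsW]; exact Module.Finite.span_of_finite K (Set.finite_range x)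
  obtain ⟨f, hfs, hfspan, -⟩ := Submodule.exists_fun_fin_finrank_span_eq K s
  have hcard : Module.finrank K (Submodule.span K s) = Fintype.card ι := by
    rw [hsW]; exact finrank_span_eq_card hx.linearIndependent
  let e : ι ≃ Fin (Module.finrank K (Submodule.span K s)) :=
    (Fintype.equivFinOfCardEq hcard.symm)
  let y : ι → L := f ∘ e
  have hys : ∀ i, y i ∈ s := fun i ↦ hfs _
  have hyspan : Submodule.span K (Set.range y) = W := by
    rw [show Set.range y = Set.range f from e.surjective.range_comp f, hfspan, hsW]
  have hadj : Algebra.adjoin K (Set.range y) = Algebra.adjoin K (Set.range x) := by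
    rw [← Algebra.adjoin_span, hyspan, Algebra.adjoin_span]
  have halg := isAlgebraic_adjoin_of_adjoin_eq_top hgen
  have hbasis : IsTranscendenceBasis K x := hx.isTranscendenceBasis_iff_isAlgebraic.mpr halg
  have hy : AlgebraicIndependent K y := by
    have : Algebra.IsAlgebraic (Algebra.adjoin K (Set.range y)) L := by rw [hadj]; exact halg
    exact (Algebra.IsAlgebraic.isTranscendenceBasis_of_lift_le_trdeg_of_finite K y
      hbasis.lift_cardinalMk_eq_trdeg.le).1
  refine ⟨y, hy, fun g i ↦ (hys i).2 g, fun S hyS hKS z hz ↦ ?_⟩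
  have hact : ∀ g, ∃ τ : K →+* K, ∀ c, b g (algebraMap K L c) = algebraMap K L (τ c) := fun g ↦
    ⟨{ toFun := σ g
       map_one' := (algebraMap K L).injective (by simp [← hσ])
       map_mul' := fun c d ↦ (algebraMap K L).injective (by simp [← hσ])
       map_zero' := (algebraMap K L).injective (by simp [← hσ])
       map_add' := fun c d ↦ (algebraMap K L).injective (by simp [← hσ]) }, hσ g⟩
  choose τ hτ using hact
  have hpoly : ∀ g (P : MvPolynomial ι K), b g (aeval y P) = aeval y (map (τ g) P) := fun g P ↦ by
    induction P using MvPolynomial.induction_on with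
    | C c => simp [hτ]
    | add P Q hP hQ => simp [hP, hQ]
    | mul_X P i hP => simp [hP, (hys i).2 g]
  let R : Subring L := (Algebra.adjoin K (Set.range y)).toSubring
  have hRmem : ∀ r, r ∈ R ↔ ∃ P : MvPolynomial ι K, aeval y P = r := fun r ↦ by
    change r ∈ Algebra.adjoin K (Set.range y) ↔ _
    rw [Algebra.adjoin_range_eq_range_aeval]; rfl
  have hRS : ∀ r ∈ R, (∀ g, b g r = r) → r ∈ S := fun r hr hinv ↦ by
    obtain ⟨P, rfl⟩ := (hRmem r).mp hr
    have hP : ∀ g, map (τ g) P = P := fun g ↦ hy (by rw [← hpoly, hinv])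
    rw [aeval_def, eval₂_eq]
    refine S.sum_mem fun d _ ↦ S.mul_mem (hKS _ fun g ↦ ?_)
      (S.prod_mem fun i _ ↦ S.pow_mem (hyS i) _)
    rw [hτ, ← coeff_map, hP]
  obtain ⟨p, hp, q, hq, hpinv, hqinv, rfl⟩ := exists_invariant_div b R
    (fun g r hr ↦ by
      obtain ⟨P, rfl⟩ := (hRmem r).mp hr
      exact (hRmem _).mpr ⟨_, (hpoly g P).symm⟩) hz (by
      have hmem : z ∈ IntermediateField.adjoin K (Set.range x) := hgen ▸ IntermediateField.mem_top
      rw [IntermediateField.mem_adjoin_iff_div, ← hadj] at hmem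
      exact hmem)
  exact S.div_mem (hRS p hp hpinv) (hRS q hq hqinv)

end NoName

section Symmetric

variable {k K L : Type*} [Field k] [Field K] [Field L] [Algebra k L] {m N : ℕ}

/-- The invariants of the symmetric group in a field generated by algebraically independent
permuted elements are generated by algebraically independent elements. -/
theorem exists_algebraicIndependent_of_permuted (b : Equiv.Perm (Fin N) →* (L ≃ₐ[k] L))
    (v : Fin N → L) (hv : AlgebraicIndependent k v) (hbv : ∀ g j, b g (v j) = v (g j)) :
    ∃ e : Fin N → L, AlgebraicIndependent k e ∧
      (∀ j, e j ∈ IntermediateField.adjoin k (Set.range v)) ∧ (∀ g j, b g (e j) = e j) ∧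
      ∀ z ∈ IntermediateField.adjoin k (Set.range v), (∀ g, b g z = z) →
        z ∈ IntermediateField.adjoin k (Set.range e) := by
  let ε : MvPolynomial (Fin N) k →ₐ[k] MvPolynomial (Fin N) k :=
    aeval fun i : Fin N ↦ esymm (Fin N) k (i + 1)
  have hε : ∀ P, ε P = (esymmAlgHom (Fin N) k N P).val := fun P ↦ (esymmAlgHom_apply P).symm
  have hact : ∀ g (P : MvPolynomial (Fin N) k), b g (aeval v P) = aeval v (rename g P) :=
      fun g P ↦ by
    induction P using MvPolynomial.induction_on with
    | C c => simp
    | add P Q hP hQ => simp [hP, hQ]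
    | mul_X P i hP => simp [hP, hbv]
  let e : Fin N → L := fun i ↦ aeval v (esymm (Fin N) k (i + 1))
  have he : ∀ P, aeval e P = aeval v (ε P) := fun P ↦ by
    have : (aeval e : MvPolynomial (Fin N) k →ₐ[k] L) = (aeval v).comp ε := by
      ext i; simp [e, ε]
    rw [this]; rfl
  have hmem : ∀ r, r ∈ Algebra.adjoin k (Set.range v) ↔
      ∃ P : MvPolynomial (Fin N) k, aeval v P = r := fun r ↦ by
    rw [Algebra.adjoin_range_eq_range_aeval]; rfl
  refine ⟨e, fun P Q hPQ ↦ ?_, fun j ↦ ?_, fun g j ↦ ?_, fun z hzv hz ↦ ?_⟩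
  · rw [he, he] at hPQ
    have h := hv hPQ
    rw [hε, hε] at h
    exact esymmAlgHom_injective k (by simp) (Subtype.ext h)
  · exact IntermediateField.algebra_adjoin_le_adjoin k _ ((hmem _).mpr ⟨_, rfl⟩)
  · rw [hact, esymm_isSymmetric]
  · have hsub : ∀ r ∈ Algebra.adjoin k (Set.range v), (∀ g, b g r = r) →
        r ∈ IntermediateField.adjoin k (Set.range e) := fun r hr hinv ↦ by
      obtain ⟨P, rfl⟩ := (hmem r).mp hr
      have hP : P.IsSymmetric := fun g ↦ hv (by rw [← hact, hinv])
      obtain ⟨Q, hQ⟩ := esymmAlgHom_surjective (σ := Fin N) k (n := N) (by simp)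
        ⟨P, (mem_symmetricSubalgebra P).mpr hP⟩
      have : aeval v P = aeval e Q := by rw [he, hε, hQ]
      rw [this]
      apply IntermediateField.algebra_adjoin_le_adjoin
      rw [Algebra.adjoin_range_eq_range_aeval]
      exact ⟨Q, rfl⟩
    obtain ⟨p, hp, q, hq, hpinv, hqinv, rfl⟩ := exists_invariant_div b
      (Algebra.adjoin k (Set.range v)).toSubring
      (fun g r hr ↦ by
        obtain ⟨P, rfl⟩ := (hmem r).mp hr
        exact (hmem _).mpr ⟨_, (hact g P).symm⟩) hz
      (IntermediateField.mem_adjoin_iff_div.mp hzv)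
    exact div_mem (hsub p hp hpinv) (hsub q hq hqinv)

variable [Algebra k K] [Algebra K L] [IsScalarTower k K L]

/-- If a symmetric group acts linearly on generating variables `u` of `K` over `k`, then adjoining
`N` variables to its invariant field gives a field purely transcendental over `k`: both are the
invariants of the extension of `K` by permuted variables `v`. -/
theorem nonempty_algEquiv_of_linear_of_permuted
    (a : Equiv.Perm (Fin N) →* (K ≃ₐ[k] K)) (ha : Function.Injective a)
    (b : Equiv.Perm (Fin N) →* (L ≃ₐ[k] L))
    (hab : ∀ g c, b g (algebraMap K L c) = algebraMap K L (a g c))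
    (u : Fin m → K) (hu : AlgebraicIndependent k u)
    (hugen : IntermediateField.adjoin k (Set.range u) = ⊤)
    (hau : ∀ g i, a g (u i) ∈ Submodule.span k (Set.range u))
    (v : Fin N → L) (hv : AlgebraicIndependent K v)
    (hvgen : IntermediateField.adjoin K (Set.range v) = ⊤)
    (hbv : ∀ g j, b g (v j) = v (g j)) :
    Nonempty (FractionRing (MvPolynomial (Fin N) (IntermediateField.fixedField a.range)) ≃ₐ[k]
      FractionRing (MvPolynomial (Fin (m + N)) k)) := by
  have hfix : ∀ z, z ∈ IntermediateField.fixedField b.range ↔ ∀ g, b g z = z := fun z ↦ by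
    simp [IntermediateField.mem_fixedField_iff]
  have hfixa : ∀ z, z ∈ IntermediateField.fixedField a.range ↔ ∀ g, a g z = z := fun z ↦ by
    simp [IntermediateField.mem_fixedField_iff]
  have hvk : AlgebraicIndependent k v := hv.restrictScalars (algebraMap k K).injective
  obtain ⟨y, hy, hyinv, hygen⟩ := exists_algebraicIndependent_invariants b
    (fun g c ↦ ⟨a g c, hab g c⟩)
    (fun g hg ↦ ha (by
      ext c
      rw [map_one]
      exact (algebraMap K L).injective (by rw [← hab, hg]; rfl)))
    v hv hvgen (fun g j ↦ by rw [hbv]; exact Submodule.subset_span ⟨_, rfl⟩)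
  let F := IntermediateField.fixedField a.range
  have hyF : AlgebraicIndependent F y := hy.restrictScalars (algebraMap F K).injective
  have hT₁ : (IntermediateField.adjoin F (Set.range y)).restrictScalars k =
      IntermediateField.fixedField b.range := by
    refine le_antisymm (fun z hz ↦ ?_) fun z hz ↦ ?_
    · refine IntermediateField.adjoin_le_subfield F (Set.range y)
        (K := (IntermediateField.fixedField b.range).toSubfield) ?_ ?_ hz
      · rintro _ ⟨c, rfl⟩
        refine (hfix _).mpr fun g ↦ ?_
        rw [IsScalarTower.algebraMap_apply F K L, hab]
        exact congrArg _ ((hfixa _).mp c.2 g)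
      · rintro _ ⟨i, rfl⟩
        exact (hfix _).mpr fun g ↦ hyinv g i
    · refine hygen (IntermediateField.adjoin F (Set.range y)).toSubfield
        (fun i ↦ IntermediateField.subset_adjoin _ _ ⟨i, rfl⟩) (fun c hc ↦ ?_) z ((hfix z).mp hz)
      have hcF : c ∈ F := (hfixa c).mpr fun g ↦
        (algebraMap K L).injective (by rw [← hab, hc])
      exact (IntermediateField.adjoin F (Set.range y)).algebraMap_mem ⟨c, hcF⟩
  let E := IntermediateField.adjoin k (Set.range v)
  let u' : Fin m → L := algebraMap K L ∘ u
  have hu' : AlgebraicIndependent E u' := by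
    have h := (AlgebraicIndependent.sumElim_comp hu hv).comp Sum.swap
      Sum.swap_leftInverse.injective
    rw [show Sum.elim v (algebraMap K L ∘ u) ∘ Sum.swap = Sum.elim u' v by
      ext (_ | _) <;> rfl] at h
    open IntermediateField.algebraAdjoinAdjoin in
    exact (AlgebraicIndependent.sumElim_iff.mp h).2.extendScalars E
  have hu'gen : IntermediateField.adjoin E (Set.range u') = ⊤ := by
    refine eq_top_iff.mpr fun z _ ↦ ?_
    refine IntermediateField.adjoin_le_subfield K (Set.range v)
      (K := (IntermediateField.adjoin E (Set.range u')).toSubfield) ?_ ?_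
      (hvgen ▸ IntermediateField.mem_top : z ∈ IntermediateField.adjoin K (Set.range v))
    · rintro _ ⟨c, rfl⟩
      have hle : IntermediateField.adjoin k (Set.range u) ≤
          ((IntermediateField.adjoin E (Set.range u')).restrictScalars k).comap
            (IsScalarTower.toAlgHom k K L) := by
        rw [IntermediateField.adjoin_le_iff]
        rintro _ ⟨i, rfl⟩
        exact IntermediateField.subset_adjoin E _ ⟨i, rfl⟩
      exact hle (hugen ▸ IntermediateField.mem_top : c ∈ _)
    · rintro _ ⟨j, rfl⟩
      exact (IntermediateField.adjoin E (Set.range u')).algebraMap_mem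
        ⟨v j, IntermediateField.subset_adjoin _ _ ⟨j, rfl⟩⟩
  have hE : ∀ g, ∀ c ∈ E, b g c ∈ E := fun g ↦ by
    have : E ≤ E.comap (b g : L →ₐ[k] L) := by
      rw [IntermediateField.adjoin_le_iff]
      rintro _ ⟨j, rfl⟩
      exact IntermediateField.subset_adjoin k _ ⟨g j, (hbv g j).symm⟩
    exact this
  obtain ⟨w, hw, hwinv, hwgen⟩ := exists_algebraicIndependent_invariants (K := E) b
    (fun g c ↦ ⟨⟨b g c, hE g c c.2⟩, rfl⟩)
    (fun g hg ↦ Equiv.ext fun j ↦ hv.injective (by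
      rw [← hbv]
      exact hg ⟨v j, IntermediateField.subset_adjoin _ _ ⟨j, rfl⟩⟩))
    u' hu' hu'gen (fun g i ↦ by
      have hle : (Submodule.span k (Set.range u)) ≤
          ((Submodule.span E (Set.range u')).restrictScalars k).comap
            (IsScalarTower.toAlgHom k K L).toLinearMap := by
        rw [Submodule.span_le]
        rintro _ ⟨i, rfl⟩
        exact Submodule.subset_span ⟨i, rfl⟩
      have := hle (hau g i)
      simp only [u', Function.comp_apply, hab]
      exact this)
  obtain ⟨e, he, heE, heinv, hegen⟩ := exists_algebraicIndependent_of_permuted b v hvk hbv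
  have hwe : AlgebraicIndependent k (Sum.elim w e) :=
    he.sumElim_of_tower (S := E) (by rintro _ ⟨j, rfl⟩; exact ⟨⟨e j, heE j⟩, rfl⟩) hw
  have hT₂ : IntermediateField.adjoin k (Set.range (Sum.elim w e)) =
      IntermediateField.fixedField b.range := by
    refine le_antisymm (IntermediateField.adjoin_le_iff.mpr ?_) fun z hz ↦ ?_
    · rintro _ ⟨i | j, rfl⟩
      · exact (hfix _).mpr fun g ↦ hwinv g i
      · exact (hfix _).mpr fun g ↦ heinv g j
    · refine hwgen (IntermediateField.adjoin k (Set.range (Sum.elim w e))).toSubfield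
        (fun i ↦ IntermediateField.subset_adjoin _ _ ⟨Sum.inl i, rfl⟩) (fun c hc ↦ ?_) z
        ((hfix z).mp hz)
      refine IntermediateField.adjoin.mono k _ _ ?_ (hegen c c.2 hc)
      rintro _ ⟨j, rfl⟩
      exact ⟨Sum.inr j, rfl⟩
  let s : Fin (m + N) → L := Sum.elim w e ∘ finSumFinEquiv.symm
  have hs : AlgebraicIndependent k s := hwe.comp _ finSumFinEquiv.symm.injective
  have hsT : IntermediateField.adjoin k (Set.range s) = IntermediateField.fixedField b.range := by
    rw [← hT₂, show Set.range s = Set.range (Sum.elim w e) from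
      finSumFinEquiv.symm.surjective.range_comp _]
  have e₁ := hyF.aevalEquivField.restrictScalars k
  have e₂ := IntermediateField.equivOfEq hT₁
  have e₃ := IntermediateField.equivOfEq hsT
  exact ⟨(e₁.trans e₂).trans (e₃.symm.trans hs.aevalEquivField.symm)⟩

/-- An action of a symmetric group on `K` extends to `K(x_1, …, x_n)`, permuting the variables. -/
theorem exists_extension_permuting_variables {σ : Type*} (a : Equiv.Perm σ →* (K ≃ₐ[k] K)) :
    ∃ b : Equiv.Perm σ →* (FractionRing (MvPolynomial σ K) ≃ₐ[k] FractionRing (MvPolynomial σ K)),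
      (∀ g c, b g (algebraMap K _ c) = algebraMap K _ (a g c)) ∧
      ∀ g j, b g (algebraMap (MvPolynomial σ K) _ (X j)) =
        algebraMap (MvPolynomial σ K) _ (X (g j)) := by
  let Φ : Equiv.Perm σ →* (MvPolynomial σ K ≃ₐ[k] MvPolynomial σ K) :=
    { toFun := fun g ↦ (mapAlgEquiv σ (a g)).trans ((renameEquiv K g).restrictScalars k)
      map_one' := by
        refine AlgEquiv.ext fun P ↦ ?_
        induction P using MvPolynomial.induction_on with
        | C c => simp
        | add P Q hP hQ => simp_all
        | mul_X P i hP => simp_all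
      map_mul' := fun g h ↦ by
        refine AlgEquiv.ext fun P ↦ ?_
        induction P using MvPolynomial.induction_on with
        | C c => simp
        | add P Q hP hQ => simp_all
        | mul_X P i hP => simp_all }
  have hΦ : ∀ g c, Φ g (algebraMap K _ c) = algebraMap K _ (a g c) := fun g c ↦ by
    simp [Φ, MvPolynomial.algebraMap_eq]
  refine ⟨(IsFractionRing.fieldEquivOfAlgEquivHom k (FractionRing (MvPolynomial σ K))).comp Φ,
    fun g c ↦ ?_, fun g j ↦ ?_⟩
  · rw [IsScalarTower.algebraMap_apply K (MvPolynomial σ K),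
      IsScalarTower.algebraMap_apply K (MvPolynomial σ K), MonoidHom.comp_apply,
      IsFractionRing.fieldEquivOfAlgEquivHom_apply, IsFractionRing.fieldEquivOfAlgEquiv_algebraMap]
    exact congrArg _ (hΦ g c)
  · rw [MonoidHom.comp_apply, IsFractionRing.fieldEquivOfAlgEquivHom_apply,
      IsFractionRing.fieldEquivOfAlgEquiv_algebraMap]
    simp [Φ]

end Symmetric

theorem algebraicIndependent_algebraMap_X (σ F : Type*) [Field F] :
    AlgebraicIndependent F fun i : σ ↦
      algebraMap (MvPolynomial σ F) (FractionRing (MvPolynomial σ F)) (X i) :=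
  (algebraicIndependent_X σ F).map'
    (f := IsScalarTower.toAlgHom F (MvPolynomial σ F) (FractionRing (MvPolynomial σ F)))
    (IsFractionRing.injective _ _)

theorem adjoin_algebraMap_X_eq_top (σ F : Type*) [Field F] :
    IntermediateField.adjoin F (Set.range fun i : σ ↦
      algebraMap (MvPolynomial σ F) (FractionRing (MvPolynomial σ F)) (X i)) = ⊤ := by
  refine eq_top_iff.mpr fun z _ ↦ ?_
  have hmem : ∀ P : MvPolynomial σ F, algebraMap _ (FractionRing (MvPolynomial σ F)) P ∈
      IntermediateField.adjoin F (Set.range fun i : σ ↦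
        algebraMap (MvPolynomial σ F) (FractionRing (MvPolynomial σ F)) (X i)) := fun P ↦ by
    induction P using MvPolynomial.induction_on with
    | C c =>
      rw [← MvPolynomial.algebraMap_eq, ← IsScalarTower.algebraMap_apply]
      exact IntermediateField.algebraMap_mem _ c
    | add P Q hP hQ => rw [map_add]; exact add_mem hP hQ
    | mul_X P i hP =>
      rw [map_mul]; exact mul_mem hP (IntermediateField.subset_adjoin _ _ ⟨i, rfl⟩)
  obtain ⟨P, Q, -, rfl⟩ := IsFractionRing.div_surjective (A := MvPolynomial σ F) z
  exact div_mem (hmem P) (hmem Q)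

set_option synthInstance.maxHeartbeats 1000000
set_option maxHeartbeats 1000000

/-- Let `k` be a field of characteristic zero and `N ≥ 1`.  For any
faithful linear representation `V = k^m` of the symmetric group `S_N` (given by an
injective homomorphism `ρ : S_N →* GLₘ(k)` with induced action `a` on the rational
function field `k(V)`), the invariant field `k(V)^{S_N}` is stably pure over `k`:
after adjoining `r` indeterminates it becomes purely transcendental over `k`. -/
theorem invariant_field_of_symmetric_group_representation_stably_pure
    (k : Type) [Field k] [CharZero k]
    (N : ℕ) (hN : 1 ≤ N)
    (m : ℕ)
    (ρ : Equiv.Perm (Fin N) →* Matrix.GeneralLinearGroup (Fin m) k)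
    (hρ : Function.Injective ρ)
    (a : Equiv.Perm (Fin N) →* (FractionRing (MvPolynomial (Fin m) k) ≃ₐ[k]
      FractionRing (MvPolynomial (Fin m) k)))
    (ha : ∀ (g : Equiv.Perm (Fin N)) (i : Fin m),
      a g (algebraMap (MvPolynomial (Fin m) k) (FractionRing (MvPolynomial (Fin m) k)) (X i)) =
        algebraMap (MvPolynomial (Fin m) k) (FractionRing (MvPolynomial (Fin m) k))
          (∑ j, ((ρ g⁻¹ : Matrix (Fin m) (Fin m) k) i j) • X j)) :
    ∃ r t : ℕ, Nonempty
      (FractionRing (MvPolynomial (Fin r) (IntermediateField.fixedField a.range)) ≃ₐ[k]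
       FractionRing (MvPolynomial (Fin t) k)) := by
  have hinj : Function.Injective a := by
    refine (injective_iff_map_eq_one a).mpr fun g hg ↦ ?_
    have hmat : ρ g⁻¹ = 1 := by
      ext i l
      have h := ha g i
      rw [hg, AlgEquiv.one_apply] at h
      have h' := congrArg (coeff (Finsupp.single l 1)) (IsFractionRing.injective _ _ h)
      simp only [coeff_sum, coeff_smul, coeff_X, smul_eq_mul,
        Finsupp.single_left_inj one_ne_zero, mul_ite, mul_one, mul_zero, Finset.sum_ite_eq',
        Finset.mem_univ, if_true] at h'
      rw [← h']
      simp [Matrix.one_apply]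
    simpa using hρ (hmat.trans (map_one ρ).symm)
  obtain ⟨b, hab, hbv⟩ := exists_extension_permuting_variables a
  refine ⟨N, m + N, nonempty_algEquiv_of_linear_of_permuted a hinj b hab _
    (algebraicIndependent_algebraMap_X (Fin m) k) (adjoin_algebraMap_X_eq_top (Fin m) k)
    (fun g i ↦ ?_) _ (algebraicIndependent_algebraMap_X (Fin N) _)
    (adjoin_algebraMap_X_eq_top (Fin N) _) hbv⟩
  rw [ha, map_sum]
  refine Submodule.sum_mem _ fun j _ ↦ ?_
  rw [← IsScalarTower.coe_toAlgHom' k, map_smul]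
  exact Submodule.smul_mem _ _ (Submodule.subset_span ⟨j, rfl⟩)
end
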